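/- arXiv:1102.3243 — 4 statements merged into one kernel-verified Lean document; each statement's English description precedes it below -/
import Mathlib

section
/- Let p_1,…,p_I be primes and r_1,…,r_I positive integers, and let G = ⊕_{i=1}^I ℤ_{p_i^{r_i}} be the channel input alphabet of a discrete memoryless channel (G, 𝒴, W). Then the capacity C_G of shifted group codes over G satisfies the lower bound C_G ≥ sup over nonnegative weights w_1,…,w_I with w_1+⋯+w_I = 1 of the minimum over tuples θ = (θ_1,…,θ_I), 0 ≤ θ_i ≤ r_i, with H_θ ≠ {0}, of (Σ_{S coset of H_θ in G} (|H_θ|/|G|) · C^U_{|S|}) / w_{H_θ}. In particular every rate R strictly below this sup-min is achievable using shifted group codes over G. -/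
open scoped BigOperators Classical

noncomputable section

/-- Mutual information (in bits) between a channel input with pmf `pIn` and the
corresponding output of the channel `W`. -/
def mutualInfo {G Y : Type*} [Fintype G] [Fintype Y] (W : G → Y → ℝ) (pIn : G → ℝ) : ℝ :=
  ∑ x : G, ∑ y : Y,
    pIn x * W x y *
      Real.logb 2 ((pIn x * W x y) / (pIn x * ∑ x' : G, pIn x' * W x' y))

/-- `C^U_{|S|}` : mutual information between input and output when the input is
uniformly distributed on the subset `S`. -/
def CU {G Y : Type*} [Fintype G] [Fintype Y] (W : G → Y → ℝ) (S : Finset G) : ℝ :=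
  mutualInfo W (fun x => if x ∈ S then (S.card : ℝ)⁻¹ else 0)

/-- The `n`-fold memoryless extension of the channel `W`. -/
def Wn {G Y : Type*} (W : G → Y → ℝ) {n : ℕ} (x : Fin n → G) (y : Fin n → Y) : ℝ :=
  ∏ N, W (x N) (y N)

/-- Average probability of error of the encoder `e` and decoder `f` on the DMC `W`. -/
def avgErr {G Y : Type*} [Fintype Y] (W : G → Y → ℝ) {n M : ℕ}
    (e : Fin M → Fin n → G) (f : (Fin n → Y) → Fin M) : ℝ :=
  (M : ℝ)⁻¹ * ∑ m : Fin M, ∑ y : Fin n → Y, if f y ≠ m then Wn W (e m) y else 0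

/-- `R` is achievable over the channel `W` using shifted group codes whose underlying
group code has all its codeword components lying in `H`. -/
def achievable {G Y : Type*} [AddCommGroup G] [Fintype Y]
    (W : G → Y → ℝ) (H : Set G) (R : ℝ) : Prop :=
  0 ≤ R ∧ ∀ ε > 0, ∃ n₀ : ℕ, ∀ n ≥ n₀, ∃ M : ℕ, ∃ C : AddSubgroup (Fin n → G),
    ∃ v : Fin n → G, ∃ e : Fin M → Fin n → G, ∃ f : (Fin n → Y) → Fin M,
      (2 : ℝ) ^ ((n : ℝ) * (R - ε)) ≤ M ∧
      (∀ c ∈ C, ∀ N, c N ∈ H) ∧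
      (∀ m, e m ∈ {x | ∃ c ∈ C, x = c + v}) ∧
      (∀ x ∈ {x : Fin n → G | ∃ c ∈ C, x = c + v},
        Nat.card {m : Fin M // e m = x} * Nat.card C = M) ∧
      avgErr W e f ≤ ε

/-- capacity of shifted group codes whose components are constrained to `H`. -/
def capacity {G Y : Type*} [AddCommGroup G] [Fintype Y]
    (W : G → Y → ℝ) (H : Set G) : ℝ :=
  sSup {R : ℝ | achievable W H R}

/-- The subgroup `H_θ = ⊕ᵢ pᵢ^{θᵢ} ℤ_{pᵢ^{rᵢ}}` of `G = ⊕ᵢ ℤ_{pᵢ^{rᵢ}}`. -/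
def Htheta {I : ℕ} (p : Fin I → ℕ) (r : Fin I → ℕ) (θ : Fin I → ℕ) :
    AddSubgroup (∀ i, ZMod (p i ^ r i)) where
  carrier := {x | ∀ i, ∃ c, x i = (p i : ZMod (p i ^ r i)) ^ θ i * c}
  zero_mem' := fun i => ⟨0, by simp⟩
  add_mem' := by
    intro a b ha hb i
    obtain ⟨c, hc⟩ := ha i
    obtain ⟨d, hd⟩ := hb i
    exact ⟨c + d, by simp [hc, hd, mul_add]⟩
  neg_mem' := by
    intro a ha i
    obtain ⟨c, hc⟩ := ha i
    exact ⟨-c, by simp [hc]⟩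

/-- The cosets of a subgroup `H` of a finite abelian group, as a finite family of finite sets. -/
def cosetsOf {G : Type*} [AddCommGroup G] [Fintype G] (H : AddSubgroup G) :
    Finset (Finset G) :=
  Finset.univ.image (fun g : G => Finset.univ.filter (fun x => x - g ∈ H))

/-- A subgroup, as a finite subset of the ambient finite group. -/
def subFinset {G : Type*} [AddCommGroup G] [Fintype G] (H : AddSubgroup G) : Finset G :=
  Finset.univ.filter (· ∈ H)

/-- `C^U_{|K*|}` : the value of `C^U` at an optimal coset `K*` of the subgroup `K`,
i.e. the maximum of `C^U_{|S|}` over all cosets `S` of `K` in `G`. -/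
def maxCosetCU {G Y : Type*} [AddCommGroup G] [Fintype G] [Fintype Y]
    (W : G → Y → ℝ) (K : AddSubgroup G) : ℝ :=
  sSup {x : ℝ | ∃ g : G, x = CU W (Finset.univ.filter (fun a => a - g ∈ K))}

/-- A subgroup `K` is maximal for the channel `W` if `C^U_{|K*|} ≥ C^U_{|S*|}`
for every subgroup `S` of `K`. -/
def isMaximalForChannel {G Y : Type*} [AddCommGroup G] [Fintype G] [Fintype Y]
    (W : G → Y → ℝ) (K : AddSubgroup G) : Prop :=
  ∀ S : AddSubgroup G, (S : Set G) ⊆ (K : Set G) → maxCosetCU W S ≤ maxCosetCU W K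


/-- The lower bound on the capacity of Abelian group codes over
`G = ⊕ᵢ ℤ_{pᵢ^{rᵢ}}` for the channel `(G, Y, W)`:
`sup` over nonnegative weights summing to one of the `inf` over tuples `θ`
(with `0 ≤ θᵢ ≤ rᵢ` and `H_θ ≠ {0}`) of
`(Σ_{S coset of H_θ} (|H_θ|/|G|) C^U_{|S|}) / w_{H_θ}`. -/
def groupCodeLowerBound {I : ℕ} (p r : Fin I → ℕ) [∀ i, NeZero (p i ^ r i)]
    {Y : Type*} [Fintype Y] (W : (∀ i, ZMod (p i ^ r i)) → Y → ℝ) : ℝ :=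
  sSup {x : ℝ | ∃ w : Fin I → ℝ, (∀ i, 0 ≤ w i) ∧ (∑ i, w i = 1) ∧
    x = sInf {y : ℝ | ∃ θ : Fin I → ℕ, (∀ i, θ i ≤ r i) ∧ Htheta p r θ ≠ ⊥ ∧
      y = (∑ S ∈ cosetsOf (Htheta p r θ),
            ((Nat.card (Htheta p r θ) : ℝ) /
              (Fintype.card (∀ i, ZMod (p i ^ r i)) : ℝ)) * CU W S) /
          (∑ i, (((r i : ℝ) - (θ i : ℝ)) / (r i : ℝ)) * w i)}}

lemma aux_chernoff {Z : Type*} [Fintype Z] (P : Z → ℝ) (hP0 : ∀ z, 0 ≤ P z)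
    (hP1 : ∑ z, P z = 1) (f : Z → ℝ) (δ : ℝ) (hδ : 0 < δ) :
    ∃ ρ : ℝ, 0 ≤ ρ ∧ ρ < 1 ∧ ∀ n : ℕ, ∑ z : Fin n → Z,
      (if ∑ N, f (z N) ≤ n * ((∑ z, P z * f z) - δ) then ∏ N, P (z N) else 0) ≤ ρ ^ n := by
  set μ := ∑ z, P z * f z with hμ
  set u : Z → ℝ := fun z => μ - δ - f z with hu
  have hEu : ∑ z, P z * u z = -δ := by
    simp only [hu, mul_sub, Finset.sum_sub_distrib, ← Finset.sum_mul, hP1, ← hμ]; ring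
  set B : ℝ := 1 + δ + ∑ z, |u z| with hB
  have hS : 0 ≤ ∑ z, |u z| := Finset.sum_nonneg fun _ _ => abs_nonneg _
  have hB1 : 1 ≤ B := by linarith
  have hBδ : δ ≤ B := by linarith
  have hBu : ∀ z, |u z| ≤ B := fun z => by
    have := Finset.single_le_sum (f := fun z => |u z|) (fun _ _ => abs_nonneg _) (Finset.mem_univ z)
    linarith
  set s : ℝ := δ / (2 * B ^ 2) with hs
  have hB0 : 0 < B := by linarith
  have hs0 : 0 < s := by positivity
  have hsB2 : s * B ^ 2 = δ / 2 := by rw [hs]; field_simp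
  have hsB : s * B ≤ 1 := by
    have : s * B * B ≤ 1 * B := by nlinarith
    exact le_of_mul_le_mul_right this hB0
  have hexp : ∀ z, Real.exp (s * u z) ≤ 1 + s * u z + s ^ 2 * B ^ 2 := fun z => by
    have h1 : |s * u z| ≤ 1 := by
      rw [abs_mul, abs_of_pos hs0]
      exact le_trans (mul_le_mul_of_nonneg_left (hBu z) hs0.le) hsB
    have h2 := (abs_le.1 (Real.abs_exp_sub_one_sub_id_le h1)).2
    have h3 : (u z) ^ 2 ≤ B ^ 2 := by
      rw [← sq_abs]; exact pow_le_pow_left₀ (abs_nonneg _) (hBu z) 2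
    have h4 : s ^ 2 * (u z) ^ 2 ≤ s ^ 2 * B ^ 2 := mul_le_mul_of_nonneg_left h3 (by positivity)
    nlinarith
  refine ⟨∑ z, P z * Real.exp (s * u z),
    Finset.sum_nonneg fun z _ => mul_nonneg (hP0 z) (Real.exp_pos _).le, ?_, ?_⟩
  · calc ∑ z, P z * Real.exp (s * u z) ≤ ∑ z, P z * (1 + s * u z + s ^ 2 * B ^ 2) :=
          Finset.sum_le_sum fun z _ => mul_le_mul_of_nonneg_left (hexp z) (hP0 z)
      _ = ∑ z, (P z * (1 + s ^ 2 * B ^ 2) + s * (P z * u z)) :=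
          Finset.sum_congr rfl fun z _ => by ring
      _ = (1 + s ^ 2 * B ^ 2) + s * (-δ) := by
          rw [Finset.sum_add_distrib, ← Finset.sum_mul, ← Finset.mul_sum, hP1, hEu, one_mul]
      _ < 1 := by
          have : s ^ 2 * B ^ 2 = s * (δ / 2) := by rw [← hsB2]; ring
          nlinarith [mul_pos hs0 hδ]
  · intro n
    rw [Fintype.sum_pow]
    refine Finset.sum_le_sum fun z _ => ?_
    rw [Finset.prod_mul_distrib, ← Real.exp_sum, ← Finset.mul_sum]
    have hp : 0 ≤ ∏ N, P (z N) := Finset.prod_nonneg fun _ _ => hP0 _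
    split_ifs with h
    · refine le_mul_of_one_le_right hp (Real.one_le_exp (mul_nonneg hs0.le ?_))
      simp only [hu, Finset.sum_sub_distrib, Finset.sum_const, Finset.card_univ, Fintype.card_fin,
        nsmul_eq_mul]
      linarith
    · exact mul_nonneg hp (Real.exp_pos _).le

lemma aux_sum_Wn {G Y : Type*} [Fintype Y] (W : G → Y → ℝ) (hW1 : ∀ x, ∑ y, W x y = 1)
    {n : ℕ} (x : Fin n → G) : ∑ y : Fin n → Y, Wn W x y = 1 := by
  unfold Wn
  rw [← Fintype.prod_sum (fun N y => W (x N) y)]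
  simp [hW1]

lemma aux_core {G Y J E Θ : Type*} [AddCommGroup G] [Fintype G] [Fintype Y] [AddCommGroup J]
    [Fintype J] [Fintype E] [Nonempty E] (W : G → Y → ℝ)
    (hW0 : ∀ x y, 0 ≤ W x y) (hW1 : ∀ x, ∑ y, W x y = 1)
    (b : E → J →+ G) (T : Finset Θ) (τ : J → Θ) (hτ : ∀ a, a ≠ 0 → τ a ∈ T)
    (q : Θ → G → Y → ℝ)
    (hq : ∀ a, a ≠ 0 → ∀ x y, ∑ e, W (x - b e a) y = Fintype.card E * q (τ a) x y)
    (n : ℕ) (t : Θ → ℝ) :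
    ∃ g : Fin n → E, ∃ v : Fin n → G, ∃ f : (Fin n → Y) → J,
      (Fintype.card J : ℝ)⁻¹ * ∑ m : J, ∑ y : Fin n → Y,
        (if f y ≠ m then Wn W (fun N => b (g N) m + v N) y else 0) ≤
      ((Fintype.card G : ℝ) ^ n)⁻¹ * ∑ x : Fin n → G, ∑ y : Fin n → Y,
        (if ∀ θ ∈ T, (2 : ℝ) ^ (t θ) * ∏ N, q θ (x N) (y N) < Wn W x y then 0 else Wn W x y)
      + ∑ a : J, if a = 0 then 0 else (2 : ℝ) ^ (-(t (τ a))) := by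
  have hWn0 : ∀ (x : Fin n → G) (y : Fin n → Y), 0 ≤ Wn W x y := fun x y =>
    Finset.prod_nonneg fun _ _ => hW0 _ _
  set Pass : (Fin n → G) → (Fin n → Y) → Prop := fun x y =>
    ∀ θ ∈ T, (2 : ℝ) ^ (t θ) * ∏ N, q θ (x N) (y N) < Wn W x y with hPass
  set c : (Fin n → E) → J → Fin n → G := fun g a N => b (g N) a with hc
  have hcadd : ∀ g a a', c g (a + a') = c g a + c g a' := fun g a a' => by
    funext N; simp [hc]
  let D : (Fin n → E) → (Fin n → G) → (Fin n → Y) → J := fun g v y =>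
    if h : ∃ m, Pass (c g m + v) y then h.choose else 0
  set D1 : (Fin n → G) → ℝ := fun x => ∑ y : Fin n → Y, if Pass x y then 0 else Wn W x y with hD1
  set D2 : (Fin n → G) → (Fin n → G) → ℝ := fun x z =>
    ∑ y : Fin n → Y, if Pass (x + z) y then Wn W x y else 0 with hD2
  have step1 : ∀ g v m, ∑ y : Fin n → Y, (if D g v y ≠ m then Wn W (c g m + v) y else 0) ≤
      D1 (c g m + v) + ∑ a : J, if a = 0 then 0 else D2 (c g m + v) (c g a) := by
    intro g v m
    have : ∀ a : J, (if a = 0 then 0 else D2 (c g m + v) (c g a)) = ∑ y : Fin n → Y,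
        if a ≠ 0 ∧ Pass (c g m + v + c g a) y then Wn W (c g m + v) y else 0 := by
      intro a
      by_cases ha : a = 0 <;> simp [ha, hD2]
    simp only [this]
    rw [Finset.sum_comm, hD1, ← Finset.sum_add_distrib]
    refine Finset.sum_le_sum fun y _ => ?_
    have hn : ∀ a : J, 0 ≤ (if a ≠ 0 ∧ Pass (c g m + v + c g a) y
        then Wn W (c g m + v) y else 0) := fun a => by split_ifs <;> simp [hWn0]
    have hn2 := Finset.sum_nonneg (s := Finset.univ) fun a _ => hn a
    by_cases hm : D g v y ≠ m
    · rw [if_pos hm]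
      by_cases hp : Pass (c g m + v) y
      · rw [if_pos hp, zero_add]
        have hex : ∃ m, Pass (c g m + v) y := ⟨m, hp⟩
        have hD : Pass (c g (D g v y) + v) y := by
          simp only [D, dif_pos hex]; exact hex.choose_spec
        have := Finset.single_le_sum (fun a _ => hn a) (Finset.mem_univ (D g v y - m))
        rw [if_pos] at this
        · exact this
        · refine ⟨sub_ne_zero.2 hm, ?_⟩
          have h2 : c g m + v + c g (D g v y - m) = c g (D g v y) + v := by
            have := hcadd g m (D g v y - m)
            rw [add_sub_cancel] at this
            rw [this]; abel
          rw [h2]; exact hD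
      · rw [if_neg hp]; linarith
    · rw [if_neg hm]
      refine add_nonneg ?_ hn2
      split_ifs <;> simp [hWn0]
  have step2 : ∀ a, a ≠ 0 → ∑ g : Fin n → E, ∑ x : Fin n → G, D2 x (c g a) ≤
      (Fintype.card E : ℝ) ^ n * (Fintype.card G : ℝ) ^ n * (2 : ℝ) ^ (-(t (τ a))) := by
    intro a ha
    have e1 : ∀ g, ∑ x : Fin n → G, D2 x (c g a) = ∑ x : Fin n → G, ∑ y : Fin n → Y,
        if Pass x y then Wn W (x - c g a) y else 0 := by
      intro g
      rw [← Equiv.sum_comp (Equiv.addRight (c g a)) (fun x : Fin n → G => ∑ y : Fin n → Y,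
        if Pass x y then Wn W (x - c g a) y else 0)]
      simp [hD2]
    have e2 : ∀ (x : Fin n → G) (y : Fin n → Y), ∑ g : Fin n → E, Wn W (x - c g a) y =
        (Fintype.card E : ℝ) ^ n * ∏ N, q (τ a) (x N) (y N) := by
      intro x y
      have : ∀ g : Fin n → E, Wn W (x - c g a) y = ∏ N, W (x N - b (g N) a) (y N) := fun g => rfl
      simp only [this]
      rw [← Fintype.prod_sum (fun N e => W (x N - b e a) (y N))]
      simp only [hq a ha, Finset.prod_mul_distrib]
      simp
    calc ∑ g : Fin n → E, ∑ x : Fin n → G, D2 x (c g a)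
        = ∑ x : Fin n → G, ∑ y : Fin n → Y,
            if Pass x y then ∑ g : Fin n → E, Wn W (x - c g a) y else 0 := by
          simp only [e1]
          rw [Finset.sum_comm]
          refine Finset.sum_congr rfl fun x _ => ?_
          rw [Finset.sum_comm]
          refine Finset.sum_congr rfl fun y _ => ?_
          split_ifs <;> simp
      _ ≤ ∑ x : Fin n → G, ∑ y : Fin n → Y,
            (Fintype.card E : ℝ) ^ n * (2 : ℝ) ^ (-(t (τ a))) * Wn W x y := by
          refine Finset.sum_le_sum fun x _ => Finset.sum_le_sum fun y _ => ?_
          split_ifs with hp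
          · rw [e2, mul_assoc]
            refine mul_le_mul_of_nonneg_left ?_ (by positivity)
            have := (hp (τ a) (hτ a ha)).le
            have h2 : (0 : ℝ) < 2 ^ (t (τ a)) := by positivity
            rw [Real.rpow_neg (by norm_num), inv_mul_eq_div, le_div_iff₀ h2]
            linarith
          · have := hWn0 x y
            positivity
      _ = _ := by
          simp only [← Finset.mul_sum, aux_sum_Wn W hW1]
          simp; ring
  by_contra! hcon
  set Rhs := ((Fintype.card G : ℝ) ^ n)⁻¹ * ∑ x : Fin n → G, D1 x
      + ∑ a : J, if a = 0 then 0 else (2 : ℝ) ^ (-(t (τ a))) with hRhs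
  have hcon' : ∀ g v, Fintype.card J * Rhs < ∑ m : J, (D1 (c g m + v) +
      ∑ a : J, if a = 0 then 0 else D2 (c g m + v) (c g a)) := by
    intro g v
    have h1 := hcon g v (D g v)
    have hJ : (0 : ℝ) < Fintype.card J := by exact_mod_cast Fintype.card_pos
    have h2 : Fintype.card J * Rhs < ∑ m : J, ∑ y : Fin n → Y,
        (if D g v y ≠ m then Wn W (c g m + v) y else 0) := by
      rw [inv_mul_eq_div, lt_div_iff₀ hJ] at h1
      rw [mul_comm]; exact h1
    exact h2.trans_le (Finset.sum_le_sum fun m _ => step1 g v m)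
  have hlt : ∑ g : Fin n → E, ∑ v : Fin n → G, (Fintype.card J * Rhs) <
      ∑ g : Fin n → E, ∑ v : Fin n → G, ∑ m : J, (D1 (c g m + v) +
      ∑ a : J, if a = 0 then 0 else D2 (c g m + v) (c g a)) :=
    Finset.sum_lt_sum_of_nonempty Finset.univ_nonempty fun g _ =>
      Finset.sum_lt_sum_of_nonempty Finset.univ_nonempty fun v _ => hcon' g v
  have hle : ∑ g : Fin n → E, ∑ v : Fin n → G, ∑ m : J, (D1 (c g m + v) +
      ∑ a : J, if a = 0 then 0 else D2 (c g m + v) (c g a)) ≤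
      ∑ g : Fin n → E, ∑ v : Fin n → G, (Fintype.card J * Rhs) := by
    have e3 : ∀ g, ∑ v : Fin n → G, ∑ m : J, (D1 (c g m + v) +
      ∑ a : J, if a = 0 then 0 else D2 (c g m + v) (c g a)) =
        Fintype.card J * (∑ x : Fin n → G, D1 x + ∑ a : J, if a = 0 then 0 else
          ∑ x : Fin n → G, D2 x (c g a)) := by
      intro g
      rw [Finset.sum_comm]
      have : ∀ m : J, ∑ v : Fin n → G, (D1 (c g m + v) +
        ∑ a : J, if a = 0 then 0 else D2 (c g m + v) (c g a)) =
          ∑ x : Fin n → G, D1 x + ∑ a : J, if a = 0 then 0 else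
          ∑ x : Fin n → G, D2 x (c g a) := by
        intro m
        refine (Equiv.sum_comp (Equiv.addLeft (c g m)) (fun x => D1 x +
          ∑ a : J, if a = 0 then 0 else D2 x (c g a))).trans ?_
        have e7 : ∑ x : Fin n → G, ∑ a : J, (if a = 0 then 0 else D2 x (c g a)) =
          ∑ a : J, ∑ x : Fin n → G, (if a = 0 then 0 else D2 x (c g a)) := Finset.sum_comm
        rw [Finset.sum_add_distrib, e7]
        congr 1
        refine Finset.sum_congr rfl fun a _ => ?_
        split_ifs <;> simp
      simp only [this, Finset.sum_const, Finset.card_univ, nsmul_eq_mul]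
    simp only [e3]
    have e6 : ∑ g : Fin n → E, ∑ a : J, (if a = 0 then 0 else ∑ x : Fin n → G, D2 x (c g a)) =
        ∑ a : J, ∑ g : Fin n → E, (if a = 0 then 0 else ∑ x : Fin n → G, D2 x (c g a)) :=
      Finset.sum_comm
    rw [← Finset.mul_sum, Finset.sum_add_distrib, e6]
    have e4 : ∑ a : J, ∑ g : Fin n → E, (if a = 0 then 0 else ∑ x : Fin n → G, D2 x (c g a)) ≤
        ∑ a : J, if a = 0 then 0 else
          (Fintype.card E : ℝ) ^ n * (Fintype.card G : ℝ) ^ n * (2 : ℝ) ^ (-(t (τ a))) := by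
      refine Finset.sum_le_sum fun a _ => ?_
      by_cases ha : a = 0
      · simp [ha]
      · simp only [ha, if_false]; exact step2 a ha
    have e5 : (∑ a : J, if a = 0 then 0 else
          (Fintype.card E : ℝ) ^ n * (Fintype.card G : ℝ) ^ n * (2 : ℝ) ^ (-(t (τ a)))) =
        (Fintype.card E : ℝ) ^ n * (Fintype.card G : ℝ) ^ n *
          ∑ a : J, if a = 0 then 0 else (2 : ℝ) ^ (-(t (τ a))) := by
      rw [Finset.mul_sum]
      refine Finset.sum_congr rfl fun a _ => ?_
      split_ifs <;> simp
    have hG : ((Fintype.card G : ℝ) ^ n) ≠ 0 := by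
      have : 0 < Fintype.card G := Fintype.card_pos
      positivity
    simp only [Finset.sum_const, Finset.card_univ, nsmul_eq_mul, Fintype.card_pi, Finset.prod_const,
      Fintype.card_fin, Nat.cast_pow]
    calc _ ≤ (Fintype.card J : ℝ) * ((Fintype.card E : ℝ) ^ n * ∑ x : Fin n → G, D1 x +
        (Fintype.card E : ℝ) ^ n * (Fintype.card G : ℝ) ^ n *
          ∑ a : J, if a = 0 then 0 else (2 : ℝ) ^ (-(t (τ a)))) := by
            refine mul_le_mul_of_nonneg_left ?_ (by positivity)
            linarith
      _ = _ := by
        rw [hRhs]; field_simp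
  exact absurd hlt (not_lt.2 hle)

def qH {G Y : Type*} [AddCommGroup G] [Fintype G] (W : G → Y → ℝ) (H : AddSubgroup G)
    (x : G) (y : Y) : ℝ :=
  (Nat.card H : ℝ)⁻¹ * ∑ x' ∈ Finset.univ.filter (fun x' => x' - x ∈ H), W x' y

lemma aux_card_coset {G : Type*} [AddCommGroup G] [Fintype G] (H : AddSubgroup G) (x : G) :
    (Finset.univ.filter (fun x' => x' - x ∈ H)).card = Nat.card H := by
  rw [Nat.card_eq_fintype_card, Fintype.card_subtype]
  refine Finset.card_bij (fun a _ => a - x) ?_ ?_ ?_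
  · intro a ha; simpa using ha
  · intro a _ b _ h; simpa using h
  · intro b hb; exact ⟨b + x, by simpa using hb, by simp⟩

lemma aux_hom_avg {E G : Type*} [AddCommGroup E] [Fintype E] [AddCommGroup G] [Fintype G]
    (ψ : E →+ G) (H : AddSubgroup G) (hH : ∀ z, z ∈ H ↔ ∃ e, z = ψ e) (F : G → ℝ) (x : G) :
    ∑ e, F (x - ψ e) = Fintype.card E * ((Nat.card H : ℝ)⁻¹ *
      ∑ x' ∈ Finset.univ.filter (fun x' => x' - x ∈ H), F x') := by
  have hc : (Nat.card H : ℝ) ≠ 0 := by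
    have : 0 < Nat.card H := Nat.card_pos
    positivity
  have h1 : ∀ h ∈ H, ∑ e, F (x - ψ e + h) = ∑ e, F (x - ψ e) := by
    intro h hh
    obtain ⟨e0, rfl⟩ := (hH h).1 hh
    rw [← Equiv.sum_comp (Equiv.addRight e0) (fun e => F (x - ψ e + ψ e0))]
    refine Finset.sum_congr rfl fun e _ => ?_
    simp only [Equiv.coe_addRight, map_add]
    congr 1
    abel
  have h2 : ∑ h : H, ∑ e, F (x - ψ e + h) = Nat.card H * ∑ e, F (x - ψ e) := by
    rw [Finset.sum_congr rfl fun (h : H) _ => h1 h h.2]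
    simp
  have h3 : ∀ e, ∑ h : H, F (x - ψ e + h) =
      ∑ x' ∈ Finset.univ.filter (fun x' => x' - x ∈ H), F x' := by
    intro e
    have he : ψ e ∈ H := (hH _).2 ⟨e, rfl⟩
    refine Finset.sum_bij (fun h _ => x - ψ e + h) ?_ ?_ ?_ ?_
    · intro h _
      have : x - ψ e + (h : G) - x = h - ψ e := by abel
      simp only [Finset.mem_filter, Finset.mem_univ, true_and, this]
      exact H.sub_mem h.2 he
    · intro a _ b _ hab
      exact Subtype.ext (by simpa using hab)
    · intro z hz
      simp only [Finset.mem_filter, Finset.mem_univ, true_and] at hz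
      exact ⟨⟨z - x + ψ e, H.add_mem hz he⟩, Finset.mem_univ _, by simp⟩
    · intro _ _; rfl
  rw [Finset.sum_comm, Finset.sum_congr rfl fun e _ => h3 e, Finset.sum_const, Finset.card_univ,
    nsmul_eq_mul] at h2
  field_simp
  linarith

lemma aux_info {G Y : Type*} [AddCommGroup G] [Fintype G] [Fintype Y] (W : G → Y → ℝ)
    (H : AddSubgroup G) :
    ∑ S ∈ cosetsOf H, ((Nat.card H : ℝ) / (Fintype.card G : ℝ)) * CU W S =
    ∑ z : G × Y, ((Fintype.card G : ℝ)⁻¹ * W z.1 z.2) *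
      Real.logb 2 (W z.1 z.2 / qH W H z.1 z.2) := by
  have hc : (Nat.card H : ℝ) ≠ 0 := by
    have : 0 < Nat.card H := Nat.card_pos
    positivity
  set K : G → Finset G := fun g => Finset.univ.filter (fun x => x - g ∈ H) with hK
  have hmem : ∀ x g, x ∈ K g → K g = K x := by
    intro x g h
    ext z
    simp only [hK, Finset.mem_filter, Finset.mem_univ, true_and] at h ⊢
    constructor
    · intro hz
      have := H.sub_mem hz h
      simpa using this
    · intro hz
      have := H.add_mem hz h
      simpa using this
  have h1 : ∀ S ∈ cosetsOf H, ((Nat.card H : ℝ) / (Fintype.card G : ℝ)) * CU W S =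
      ∑ x : G, if x ∈ S then ∑ y : Y, ((Fintype.card G : ℝ)⁻¹ * W x y) *
        Real.logb 2 (W x y / qH W H x y) else 0 := by
    intro S hS
    simp only [cosetsOf, Finset.mem_image, Finset.mem_univ, true_and] at hS
    obtain ⟨g, rfl⟩ := hS
    change _ * CU W (K g) = ∑ x : G, if x ∈ K g then _ else 0
    unfold CU mutualInfo
    rw [Finset.mul_sum]
    refine Finset.sum_congr rfl fun x _ => ?_
    have hcard : (K g).card = Nat.card H := aux_card_coset H g
    by_cases hx : x ∈ K g
    · rw [if_pos hx, Finset.mul_sum]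
      refine Finset.sum_congr rfl fun y _ => ?_
      have hq : ∑ x', (if x' ∈ K g then ((K g).card : ℝ)⁻¹ else 0) * W x' y = qH W H x y := by
        have : qH W H x y = (Nat.card H : ℝ)⁻¹ * ∑ x' ∈ K x, W x' y := rfl
        rw [this, hcard, ← hmem x g hx, Finset.mul_sum, ← Finset.sum_filter_add_sum_filter_not Finset.univ (· ∈ K g)]
        rw [Finset.sum_congr rfl (g := fun x' => (Nat.card H : ℝ)⁻¹ * W x' y)
          (fun x' hx' => by rw [if_pos (Finset.mem_filter.1 hx').2])]
        rw [Finset.sum_eq_zero (s := Finset.univ.filter (fun x' => ¬ x' ∈ K g))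
          (fun x' hx' => by rw [if_neg (Finset.mem_filter.1 hx').2, zero_mul])]
        simp
      rw [hq]
      simp only [hcard, if_pos hx]
      rw [mul_div_mul_left _ _ (inv_ne_zero hc)]
      field_simp
    · simp [hx]
  rw [Finset.sum_congr rfl h1, Finset.sum_comm, Fintype.sum_prod_type]
  refine Finset.sum_congr rfl fun x _ => ?_
  have hxx : x ∈ K x := by simp [hK]
  have hKx : K x ∈ cosetsOf H := by
    simp only [cosetsOf, Finset.mem_image, Finset.mem_univ, true_and]
    exact ⟨x, rfl⟩
  rw [Finset.sum_eq_single_of_mem (K x) hKx]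
  · rw [if_pos hxx]
  · intro S hS hne
    rw [if_neg]
    intro hxS
    simp only [cosetsOf, Finset.mem_image, Finset.mem_univ, true_and] at hS
    obtain ⟨g, rfl⟩ := hS
    exact hne (hmem x g hxS)

lemma aux_tail {G Y : Type*} [AddCommGroup G] [Fintype G] [Fintype Y] (W : G → Y → ℝ)
    (hW0 : ∀ x y, 0 ≤ W x y) (hW1 : ∀ x, ∑ y, W x y = 1) (H : AddSubgroup G)
    (δ : ℝ) (hδ : 0 < δ) :
    ∃ ρ : ℝ, 0 ≤ ρ ∧ ρ < 1 ∧ ∀ n : ℕ, ((Fintype.card G : ℝ) ^ n)⁻¹ *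
      ∑ x : Fin n → G, ∑ y : Fin n → Y,
      (if (2 : ℝ) ^ ((n : ℝ) * ((∑ S ∈ cosetsOf H,
        ((Nat.card H : ℝ) / (Fintype.card G : ℝ)) * CU W S) - δ)) *
          ∏ N, qH W H (x N) (y N) < Wn W x y then 0 else Wn W x y) ≤ ρ ^ n := by
  rw [aux_info]
  have hG : (Fintype.card G : ℝ) ≠ 0 := by
    have : 0 < Fintype.card G := Fintype.card_pos
    positivity
  obtain ⟨ρ, h0, h1, h⟩ := aux_chernoff (fun z : G × Y => (Fintype.card G : ℝ)⁻¹ * W z.1 z.2)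
    (fun z => mul_nonneg (by positivity) (hW0 _ _))
    (by rw [Fintype.sum_prod_type]; simp only [← Finset.mul_sum, hW1]; simp [hG])
    (fun z => Real.logb 2 (W z.1 z.2 / qH W H z.1 z.2)) δ hδ
  refine ⟨ρ, h0, h1, fun n => le_trans ?_ (h n)⟩
  set Iq := ∑ z : G × Y, ((Fintype.card G : ℝ)⁻¹ * W z.1 z.2) *
      Real.logb 2 (W z.1 z.2 / qH W H z.1 z.2) with hIq
  rw [← Equiv.sum_comp (Equiv.arrowProdEquivProdArrow (Fin n) (fun _ => G) (fun _ => Y)).symm,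
    Fintype.sum_prod_type, Finset.mul_sum]
  refine Finset.sum_le_sum fun x _ => ?_
  rw [Finset.mul_sum]
  refine Finset.sum_le_sum fun y _ => ?_
  simp only [Equiv.arrowProdEquivProdArrow, Equiv.coe_fn_symm_mk, Finset.prod_mul_distrib]
  have hWn : ∏ N, W (x N) (y N) = Wn W x y := rfl
  have hWn0 : 0 ≤ Wn W x y := Finset.prod_nonneg fun _ _ => hW0 _ _
  rw [hWn]
  simp only [Finset.prod_const, Finset.card_univ, Fintype.card_fin, inv_pow]
  by_cases hz : Wn W x y = 0
  · simp [hz]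
  split_ifs with ha hb hb
  · rw [mul_zero]; positivity
  · simp
  · exact le_rfl
  exfalso
  apply hb
  have hWp : ∀ N, 0 < W (x N) (y N) := fun N =>
    lt_of_le_of_ne (hW0 _ _) (Ne.symm (Finset.prod_ne_zero_iff.1 hz N (Finset.mem_univ N)))
  have hqp : ∀ N, 0 < qH W H (x N) (y N) := fun N => by
    have : 0 < Nat.card H := Nat.card_pos
    refine mul_pos (by positivity) (lt_of_lt_of_le (hWp N) ?_)
    exact Finset.single_le_sum (f := fun x' => W x' (y N)) (fun _ _ => hW0 _ _)
      (by simp)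
  rw [← Real.logb_prod _ _ (fun N _ => (div_pos (hWp N) (hqp N)).ne'), Finset.prod_div_distrib, hWn]
  have hpp : 0 < ∏ N, qH W H (x N) (y N) := Finset.prod_pos fun N _ => hqp N
  have hWnp : 0 < Wn W x y := lt_of_le_of_ne hWn0 (Ne.symm hz)
  rw [Real.logb_le_iff_le_rpow (by norm_num) (div_pos hWnp hpp), div_le_iff₀ hpp]
  exact not_lt.1 ha

lemma aux_zmod {p r : ℕ} (hp : p.Prime) [NeZero (p ^ r)] {k : ℕ} (a : Fin k → ZMod (p ^ r)) :
    ∃ θ ≤ r, ∀ x : ZMod (p ^ r), (∃ c, x = (p : ZMod (p ^ r)) ^ θ * c) ↔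
      ∃ e : Fin k → ZMod (p ^ r), x = ∑ j, e j * a j := by
  let Q : ℕ → Prop := fun t => ∀ j, ∃ c, a j = (p : ZMod (p ^ r)) ^ t * c
  have hQ0 : Q 0 := fun j => ⟨a j, by simp⟩
  have hQ : Q (Nat.findGreatest Q r) := Nat.findGreatest_spec (Nat.zero_le r) hQ0
  have hle : Nat.findGreatest Q r ≤ r := Nat.findGreatest_le r
  set t := Nat.findGreatest Q r with ht
  refine ⟨t, hle, fun x => ⟨?_, ?_⟩⟩
  · rintro ⟨c, rfl⟩
    have hpr : (p : ZMod (p ^ r)) ^ r = 0 := by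
      have := ZMod.natCast_self (p ^ r)
      rwa [Nat.cast_pow] at this
    rcases hle.eq_or_lt with h | h
    · exact ⟨0, by simp [h, hpr]⟩
    · have hnot : ¬ Q (t + 1) := by
        intro h'
        have := Nat.le_findGreatest (P := Q) (Nat.succ_le_of_lt h) h'
        omega
      simp only [Q, not_forall] at hnot
      obtain ⟨j, hj⟩ := hnot
      obtain ⟨d, hd⟩ := hQ j
      have hdu : IsUnit d := by
        have hv : (d.val : ZMod (p ^ r)) = d := ZMod.natCast_zmod_val d
        rw [← hv, ZMod.isUnit_iff_coprime]
        refine Nat.Coprime.pow_right r ?_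
        rw [Nat.coprime_comm, Nat.Prime.coprime_iff_not_dvd hp]
        rintro ⟨m, hm⟩
        apply hj
        refine ⟨(m : ZMod (p ^ r)), ?_⟩
        rw [hd, ← hv, hm]; push_cast; ring
      obtain ⟨u, rfl⟩ := hdu
      refine ⟨Pi.single j (c * ((u⁻¹ : (ZMod (p ^ r))ˣ) : ZMod (p ^ r))), ?_⟩
      rw [Finset.sum_eq_single j]
      · rw [Pi.single_eq_same, hd]
        have : ((u⁻¹ : (ZMod (p ^ r))ˣ) : ZMod (p ^ r)) * (u : ZMod (p ^ r)) = 1 := by simp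
        linear_combination (-(p : ZMod (p ^ r)) ^ t * c) * this
      · intro b _ hb; simp [Pi.single_eq_of_ne hb]
      · simp
  · rintro ⟨e, rfl⟩
    choose c hc using hQ
    refine ⟨∑ j, e j * c j, ?_⟩
    rw [Finset.mul_sum]
    refine Finset.sum_congr rfl fun j _ => ?_
    rw [hc j]; ring

lemma aux_zcard {p r : ℕ} (hp : p.Prime) [NeZero (p ^ r)] {θ : ℕ} (hθ : θ ≤ r) :
    (Finset.univ.filter (fun x : ZMod (p ^ r) => ∃ c, x = (p : ZMod (p ^ r)) ^ θ * c)).card ≤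
      p ^ (r - θ) := by
  have : Finset.univ.filter (fun x : ZMod (p ^ r) => ∃ c, x = (p : ZMod (p ^ r)) ^ θ * c) ⊆
      (Finset.range (p ^ (r - θ))).image
        (fun j : ℕ => (p : ZMod (p ^ r)) ^ θ * (j : ZMod (p ^ r))) := by
    intro x hx
    simp only [Finset.mem_filter, Finset.mem_univ, true_and] at hx
    obtain ⟨c, rfl⟩ := hx
    have hpr : (p : ZMod (p ^ r)) ^ θ * (p : ZMod (p ^ r)) ^ (r - θ) = 0 := by
      have := ZMod.natCast_self (p ^ r)
      rw [← pow_add, Nat.add_sub_cancel' hθ]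
      rwa [Nat.cast_pow] at this
    refine Finset.mem_image.2 ⟨c.val % p ^ (r - θ), ?_, ?_⟩
    · exact Finset.mem_range.2 (Nat.mod_lt _ (pow_pos hp.pos _))
    · have hv : (c.val : ZMod (p ^ r)) = c := ZMod.natCast_zmod_val c
      have h2 := congrArg (fun m : ℕ => (m : ZMod (p ^ r))) (Nat.div_add_mod c.val (p ^ (r - θ)))
      simp only [Nat.cast_add, Nat.cast_mul, Nat.cast_pow, hv] at h2
      generalize ((c.val % p ^ (r - θ) : ℕ) : ZMod (p ^ r)) = m at *
      linear_combination ((p : ZMod (p ^ r)) ^ θ) * h2 - ((c.val / p ^ (r - θ) : ℕ) : ZMod (p ^ r)) * hpr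
  exact (Finset.card_le_card this).trans (Finset.card_image_le.trans (by simp))

def bil {I : ℕ} (p r k : Fin I → ℕ) :
    (∀ i, Fin (k i) → ZMod (p i ^ r i)) →
      (∀ i, Fin (k i) → ZMod (p i ^ r i)) →+ (∀ i, ZMod (p i ^ r i)) := fun e =>
  { toFun := fun a i => ∑ j, e i j * a i j
    map_zero' := by funext i; simp
    map_add' := by intro a b; funext i; simp [mul_add, Finset.sum_add_distrib] }

lemma aux_J {I : ℕ} (p r k : Fin I → ℕ) [∀ i, NeZero (p i ^ r i)]
    (hp : ∀ i, (p i).Prime) :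
    ∃ τ : (∀ i, Fin (k i) → ZMod (p i ^ r i)) → (Fin I → ℕ),
      (∀ a i, τ a i ≤ r i) ∧ (∀ a, a ≠ 0 → Htheta p r (τ a) ≠ ⊥) ∧
      (∀ a z, z ∈ Htheta p r (τ a) ↔ ∃ e, z = bil p r k e a) ∧
      ∀ θ : Fin I → ℕ, (∀ i, θ i ≤ r i) →
        (Finset.univ.filter (fun a => τ a = θ)).card ≤ ∏ i, p i ^ ((r i - θ i) * k i) := by
  choose τ hτ1 hτ2 using fun (i : Fin I) (a : Fin (k i) → ZMod (p i ^ r i)) => aux_zmod (hp i) a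
  have hself : ∀ i (a : Fin (k i) → ZMod (p i ^ r i)) j,
      ∃ c, a j = (p i : ZMod (p i ^ r i)) ^ τ i a * c := by
    intro i a j
    refine (hτ2 i a (a j)).2 ⟨Pi.single j 1, ?_⟩
    rw [Finset.sum_eq_single j]
    · simp
    · intro b _ hb; simp [Pi.single_eq_of_ne hb]
    · simp
  have hmem : ∀ (a : ∀ i, Fin (k i) → ZMod (p i ^ r i)) z,
      z ∈ Htheta p r (fun i => τ i (a i)) ↔ ∃ e, z = bil p r k e a := by
    intro a z
    constructor
    · intro hz
      have : ∀ i, ∃ e : Fin (k i) → ZMod (p i ^ r i), z i = ∑ j, e j * a i j := fun i =>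
        (hτ2 i (a i) (z i)).1 (hz i)
      choose e he using this
      exact ⟨e, funext he⟩
    · rintro ⟨e, rfl⟩ i
      exact (hτ2 i (a i) _).2 ⟨e i, rfl⟩
  refine ⟨fun a i => τ i (a i), fun a i => hτ1 i (a i), ?_, hmem, ?_⟩
  · intro a ha hbot
    apply ha
    funext i j
    have : (Pi.single i (a i j) : ∀ i, ZMod (p i ^ r i)) ∈ Htheta p r (fun i => τ i (a i)) := by
      intro i'
      by_cases h : i' = i
      · subst h
        rw [Pi.single_eq_same]; exact hself _ _ _
      · exact ⟨0, by rw [Pi.single_eq_of_ne h]; simp⟩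
    rw [hbot, AddSubgroup.mem_bot] at this
    have h2 := congrFun this i
    rw [Pi.single_eq_same] at h2
    exact h2
  · intro θ hθ
    have hsub : Finset.univ.filter (fun a : ∀ i, Fin (k i) → ZMod (p i ^ r i) =>
        (fun i => τ i (a i)) = θ) ⊆
        Fintype.piFinset (fun i => Fintype.piFinset (fun _ : Fin (k i) =>
          Finset.univ.filter (fun x : ZMod (p i ^ r i) =>
            ∃ c, x = (p i : ZMod (p i ^ r i)) ^ θ i * c))) := by
      intro a ha
      simp only [Finset.mem_filter, Finset.mem_univ, true_and] at ha
      simp only [Fintype.mem_piFinset, Finset.mem_filter, Finset.mem_univ, true_and]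
      intro i j
      rw [← ha]
      exact hself i (a i) j
    refine (Finset.card_le_card hsub).trans ?_
    rw [Fintype.card_piFinset]
    refine Finset.prod_le_prod' fun i _ => ?_
    rw [Fintype.card_piFinset, Finset.prod_const, Finset.card_univ, Fintype.card_fin, pow_mul]
    exact Nat.pow_le_pow_left (aux_zcard (hp i) (hθ i)) _

lemma aux_comm {A B C : Type*} [Fintype B] [Fintype C] (T : Finset A) (F : A → B → C → ℝ) :
    ∑ θ ∈ T, ∑ x, ∑ y, F θ x y = ∑ x, ∑ y, ∑ θ ∈ T, F θ x y := by
  rw [Finset.sum_comm]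
  exact Finset.sum_congr rfl fun x _ => Finset.sum_comm

lemma aux_zero {G Y : Type*} [AddCommGroup G] [Fintype Y] (W : G → Y → ℝ) :
    achievable W Set.univ 0 := by
  refine ⟨le_rfl, fun ε hε => ⟨0, fun n _ => ⟨1, ⊥, 0, fun _ => 0, fun _ => 0, ?_, ?_, ?_, ?_, ?_⟩⟩⟩
  · rw [Nat.cast_one]
    refine Real.rpow_le_one_of_one_le_of_nonpos (by norm_num) ?_
    have : (0 : ℝ) ≤ n := Nat.cast_nonneg n
    nlinarith
  · simp
  · intro m; exact ⟨0, by simp, by simp⟩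
  · rintro x ⟨c, hc, rfl⟩
    rw [AddSubgroup.mem_bot] at hc
    subst hc
    simp
  · unfold avgErr
    have : ∀ (m : Fin 1), (0 : Fin 1) ≠ m ↔ False := fun m => by
      simp [Subsingleton.elim m 0]
    simp only [this, if_false, Finset.sum_const_zero, mul_zero]
    exact hε.le

lemma aux_bdd {G Y : Type*} [AddCommGroup G] [Fintype G] [Fintype Y] (W : G → Y → ℝ)
    (hW0 : ∀ x y, 0 ≤ W x y) (hW1 : ∀ x, ∑ y, W x y = 1) (R : ℝ)
    (h : achievable W Set.univ R) : R ≤ Real.logb 2 (Fintype.card G) + 2 := by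
  obtain ⟨_, h⟩ := h
  obtain ⟨n₀, h⟩ := h (1 / 4) (by norm_num)
  obtain ⟨n, hn⟩ : ∃ n, n = n₀ + 1 := ⟨_, rfl⟩
  obtain ⟨M, C, v, e, f, hM, -, -, -, herr⟩ := h n (by omega)
  have hMp : (0 : ℝ) < M := lt_of_lt_of_le (by positivity) hM
  have hWn0 : ∀ (x : Fin n → G) (y : Fin n → Y), 0 ≤ Wn W x y := fun x y =>
    Finset.prod_nonneg fun _ _ => hW0 _ _
  have h1 : ∑ m : Fin M, ∑ y : Fin n → Y, (if f y ≠ m then Wn W (e m) y else 0) +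
      ∑ y : Fin n → Y, Wn W (e (f y)) y = M := by
    have : ∑ y : Fin n → Y, Wn W (e (f y)) y =
        ∑ m : Fin M, ∑ y : Fin n → Y, (if f y = m then Wn W (e m) y else 0) := by
      rw [Finset.sum_comm]
      refine Finset.sum_congr rfl fun y _ => ?_
      simp
    rw [this, ← Finset.sum_add_distrib]
    have h2 : ∀ m : Fin M, (∑ y : Fin n → Y, (if f y ≠ m then Wn W (e m) y else 0) +
        ∑ y : Fin n → Y, (if f y = m then Wn W (e m) y else 0)) = 1 := by
      intro m
      rw [← Finset.sum_add_distrib, ← aux_sum_Wn W hW1 (e m)]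
      refine Finset.sum_congr rfl fun y _ => ?_
      by_cases hy : f y = m <;> simp [hy]
    simp only [h2, Finset.sum_const, Finset.card_univ, Fintype.card_fin, nsmul_eq_mul, mul_one]
  have h2 : ∑ y : Fin n → Y, Wn W (e (f y)) y ≤ (Fintype.card G : ℝ) ^ n := by
    calc _ ≤ ∑ y : Fin n → Y, ∑ x : Fin n → G, Wn W x y := Finset.sum_le_sum fun y _ =>
            Finset.single_le_sum (f := fun x => Wn W x y) (fun x _ => hWn0 x y)
              (Finset.mem_univ (e (f y)))
      _ = _ := by
        rw [Finset.sum_comm]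
        simp only [aux_sum_Wn W hW1]
        simp
  have h3 : ∑ m : Fin M, ∑ y : Fin n → Y, (if f y ≠ m then Wn W (e m) y else 0) ≤ 1 / 4 * M := by
    unfold avgErr at herr
    rwa [inv_mul_eq_div, div_le_iff₀ hMp] at herr
  have h4 : (M : ℝ) ≤ 2 * (Fintype.card G : ℝ) ^ n := by linarith
  have hG : (0 : ℝ) < Fintype.card G := by exact_mod_cast Fintype.card_pos
  have h5 : (2 : ℝ) * (Fintype.card G : ℝ) ^ n =
      2 ^ (1 + (n : ℝ) * Real.logb 2 (Fintype.card G)) := by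
    rw [Real.rpow_add (by norm_num), Real.rpow_one, mul_comm (n : ℝ), Real.rpow_mul (by norm_num),
      Real.rpow_logb (by norm_num) (by norm_num) hG, Real.rpow_natCast]
  have h6 := hM.trans (h4.trans h5.le)
  rw [Real.rpow_le_rpow_left_iff (by norm_num)] at h6
  have hn1 : (1 : ℝ) ≤ n := by exact_mod_cast (by omega : 1 ≤ n)
  by_contra! hcon
  nlinarith

lemma aux_pow {I : ℕ} (p m : Fin I → ℕ) (hp : ∀ i, (p i).Prime) :
    ((∏ i, p i ^ m i : ℕ) : ℝ) = 2 ^ (∑ i, (m i : ℝ) * Real.logb 2 (p i)) := by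
  rw [Real.rpow_sum_of_pos (by norm_num)]
  push_cast
  refine Finset.prod_congr rfl fun i _ => ?_
  have : (0 : ℝ) < p i := by exact_mod_cast (hp i).pos
  rw [mul_comm, Real.rpow_mul (by norm_num),
      Real.rpow_logb (by norm_num) (by norm_num) this, Real.rpow_natCast]

lemma aux_ach {I : ℕ} (p r : Fin I → ℕ) [∀ i, NeZero (p i ^ r i)]
    (hp : ∀ i, (p i).Prime) (hr : ∀ i, 0 < r i)
    {Y : Type*} [Fintype Y] (W : (∀ i, ZMod (p i ^ r i)) → Y → ℝ)
    (hW0 : ∀ x y, 0 ≤ W x y) (hW1 : ∀ x, ∑ y, W x y = 1) (R : ℝ) (hR : 0 ≤ R)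
    (w : Fin I → ℝ) (hw0 : ∀ i, 0 ≤ w i) (hw1 : ∑ i, w i = 1)
    (hmain : ∀ θ : Fin I → ℕ, (∀ i, θ i ≤ r i) → Htheta p r θ ≠ ⊥ →
      R * (∑ i, (((r i : ℝ) - (θ i : ℝ)) / (r i : ℝ)) * w i) <
        ∑ S ∈ cosetsOf (Htheta p r θ), ((Nat.card (Htheta p r θ) : ℝ) /
              (Fintype.card (∀ i, ZMod (p i ^ r i)) : ℝ)) * CU W S) :
    achievable W Set.univ R := by
  refine ⟨hR, fun ε hε => ?_⟩
  set T : Finset (Fin I → ℕ) := (Fintype.piFinset (fun i => Finset.range (r i + 1))).filter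
    (fun θ => Htheta p r θ ≠ ⊥) with hT
  have hTmem : ∀ θ, θ ∈ T ↔ (∀ i, θ i ≤ r i) ∧ Htheta p r θ ≠ ⊥ := by
    intro θ
    simp [hT, Fintype.mem_piFinset]
  set Inf : (Fin I → ℕ) → ℝ := fun θ => ∑ S ∈ cosetsOf (Htheta p r θ),
    ((Nat.card (Htheta p r θ) : ℝ) / (Fintype.card (∀ i, ZMod (p i ^ r i)) : ℝ)) * CU W S with hInf
  set wt : (Fin I → ℕ) → ℝ := fun θ => ∑ i, (((r i : ℝ) - (θ i : ℝ)) / (r i : ℝ)) * w i with hwt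
  set δ : (Fin I → ℕ) → ℝ := fun θ => (Inf θ - R * wt θ) / 2 with hδ
  have hδ0 : ∀ θ ∈ T, 0 < δ θ := fun θ hθ => by
    have := hmain θ ((hTmem θ).1 hθ).1 ((hTmem θ).1 hθ).2
    have h2 : R * wt θ < Inf θ := this
    simp only [hδ]; linarith
  have htail : ∀ θ : Fin I → ℕ, ∃ ρ : ℝ, θ ∈ T → 0 ≤ ρ ∧ ρ < 1 ∧ ∀ n : ℕ,
      ((Fintype.card (∀ i, ZMod (p i ^ r i)) : ℝ) ^ n)⁻¹ *
      ∑ x : Fin n → (∀ i, ZMod (p i ^ r i)), ∑ y : Fin n → Y,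
      (if (2 : ℝ) ^ ((n : ℝ) * (Inf θ - δ θ)) *
          ∏ N, qH W (Htheta p r θ) (x N) (y N) < Wn W x y then 0 else Wn W x y) ≤ ρ ^ n := by
    intro θ
    by_cases hθ : θ ∈ T
    · obtain ⟨ρ, h⟩ := aux_tail W hW0 hW1 (Htheta p r θ) (δ θ) (hδ0 θ hθ)
      exact ⟨ρ, fun _ => h⟩
    · exact ⟨0, fun h => absurd h hθ⟩
  choose ρ hρ using htail
  set lp : Fin I → ℝ := fun i => Real.logb 2 (p i) with hlp
  have hlp0 : ∀ i, 0 < lp i := fun i => Real.logb_pos (by norm_num) (by exact_mod_cast (hp i).one_lt)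
  have hr0 : ∀ i, (0 : ℝ) < r i := fun i => by exact_mod_cast hr i
  set K : ℝ := 2 ^ (∑ i, (r i : ℝ) * lp i) with hKdef
  have hK0 : 0 < K := by positivity
  have hlim : Filter.Tendsto (fun n : ℕ => ∑ θ ∈ T, (ρ θ) ^ n +
      ∑ θ ∈ T, K * ((2 : ℝ) ^ (-(δ θ))) ^ n) Filter.atTop (nhds 0) := by
    have e0 : (0 : ℝ) = ∑ θ ∈ T, (0 : ℝ) + ∑ θ ∈ T, K * 0 := by simp
    rw [e0]
    refine Filter.Tendsto.add (tendsto_finsetSum _ fun θ hθ => ?_)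
      (tendsto_finsetSum _ fun θ hθ => ?_)
    · exact tendsto_pow_atTop_nhds_zero_of_lt_one (hρ θ hθ).1 (hρ θ hθ).2.1
    · refine Filter.Tendsto.const_mul K (tendsto_pow_atTop_nhds_zero_of_lt_one (by positivity) ?_)
      exact Real.rpow_lt_one_of_one_lt_of_neg (by norm_num) (by linarith [hδ0 θ hθ])
  obtain ⟨n₀, hn₀⟩ := Filter.eventually_atTop.1 (hlim.eventually (ge_mem_nhds hε))
  refine ⟨n₀, fun n hn => ?_⟩
  have hsmall := hn₀ n hn
  set k : Fin I → ℕ := fun i => ⌈(n : ℝ) * R * w i / (r i * lp i)⌉₊ with hk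
  have hk1 : ∀ i, (n : ℝ) * R * w i ≤ r i * lp i * k i := fun i => by
    have h1 := Nat.le_ceil ((n : ℝ) * R * w i / (r i * lp i))
    rw [div_le_iff₀ (mul_pos (hr0 i) (hlp0 i))] at h1
    linarith
  have hk2 : ∀ i, r i * lp i * k i ≤ (n : ℝ) * R * w i + r i * lp i := fun i => by
    have hpos := mul_pos (hr0 i) (hlp0 i)
    have h1 := (Nat.ceil_lt_add_one (a := (n : ℝ) * R * w i / (r i * lp i))
      (div_nonneg (mul_nonneg (by positivity) (hw0 i)) hpos.le)).le
    have h2 := mul_le_mul_of_nonneg_left h1 hpos.le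
    rw [mul_add, mul_div_cancel₀ _ hpos.ne', mul_one] at h2
    exact h2
  obtain ⟨τ, hτ1, hτ2, hτ3, hτ4⟩ := aux_J p r k hp
  have hτT : ∀ a, a ≠ 0 → τ a ∈ T := fun a ha => (hTmem _).2 ⟨hτ1 a, hτ2 a ha⟩
  have hq : ∀ a, a ≠ 0 → ∀ x y, ∑ e, W (x - bil p r k e a) y =
      Fintype.card (∀ i, Fin (k i) → ZMod (p i ^ r i)) * qH W (Htheta p r (τ a)) x y := by
    intro a _ x y
    let ψ : (∀ i, Fin (k i) → ZMod (p i ^ r i)) →+ (∀ i, ZMod (p i ^ r i)) :=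
      { toFun := fun e => bil p r k e a
        map_zero' := by funext i; simp [bil]
        map_add' := by intro e e'; funext i; simp [bil, add_mul, Finset.sum_add_distrib] }
    exact aux_hom_avg ψ (Htheta p r (τ a)) (hτ3 a) (fun z => W z y) x
  obtain ⟨g, v, f, hf⟩ := aux_core W hW0 hW1 (bil p r k) T τ hτT
    (fun θ => qH W (Htheta p r θ)) hq n (fun θ => (n : ℝ) * (Inf θ - δ θ))
  -- bound on the first term
  have hWn0 : ∀ (x : Fin n → (∀ i, ZMod (p i ^ r i))) (y : Fin n → Y), 0 ≤ Wn W x y := fun x y =>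
    Finset.prod_nonneg fun _ _ => hW0 _ _
  have hfirst : ((Fintype.card (∀ i, ZMod (p i ^ r i)) : ℝ) ^ n)⁻¹ *
      ∑ x : Fin n → (∀ i, ZMod (p i ^ r i)), ∑ y : Fin n → Y,
      (if ∀ θ ∈ T, (2 : ℝ) ^ ((n : ℝ) * (Inf θ - δ θ)) *
          ∏ N, qH W (Htheta p r θ) (x N) (y N) < Wn W x y then 0 else Wn W x y) ≤
      ∑ θ ∈ T, (ρ θ) ^ n := by
    refine le_trans ?_ (Finset.sum_le_sum fun θ hθ => (hρ θ hθ).2.2 n)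
    rw [← Finset.mul_sum]
    refine mul_le_mul_of_nonneg_left ?_ (by positivity)
    rw [aux_comm]
    refine Finset.sum_le_sum fun x _ => ?_
    refine Finset.sum_le_sum fun y _ => ?_
    have hnn : ∀ θ ∈ T, 0 ≤ (if (2 : ℝ) ^ ((n : ℝ) * (Inf θ - δ θ)) *
          ∏ N, qH W (Htheta p r θ) (x N) (y N) < Wn W x y then 0 else Wn W x y) := by
      intro θ _
      split_ifs
      · exact le_rfl
      · exact hWn0 x y
    by_cases hall : ∀ θ ∈ T, (2 : ℝ) ^ ((n : ℝ) * (Inf θ - δ θ)) *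
          ∏ N, qH W (Htheta p r θ) (x N) (y N) < Wn W x y
    · rw [if_pos hall]; exact Finset.sum_nonneg hnn
    · rw [if_neg hall]
      push Not at hall
      obtain ⟨θ, hθ, hle⟩ := hall
      have := Finset.single_le_sum hnn hθ
      rwa [if_neg (not_lt.2 hle)] at this
  -- bound on the second term
  have hcount : ∀ θ ∈ T, ((Finset.univ.filter (fun a => τ a = θ)).card : ℝ) ≤
      K * 2 ^ ((n : ℝ) * (R * wt θ)) := by
    intro θ hθ
    have hθr := ((hTmem θ).1 hθ).1
    have h1 : ((Finset.univ.filter (fun a => τ a = θ)).card : ℝ) ≤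
      ((∏ i, p i ^ ((r i - θ i) * k i) : ℕ) : ℝ) := by exact_mod_cast hτ4 θ hθr
    refine h1.trans ?_
    rw [aux_pow p _ hp, hKdef, ← Real.rpow_add (by norm_num)]
    refine Real.rpow_le_rpow_of_exponent_le (by norm_num) ?_
    simp only [hwt, Finset.mul_sum]
    rw [← Finset.sum_add_distrib]
    refine Finset.sum_le_sum fun i _ => ?_
    change (((r i - θ i) * k i : ℕ) : ℝ) * lp i ≤ _
    rw [Nat.cast_mul, Nat.cast_sub (hθr i)]
    have hθi : (θ i : ℝ) ≤ r i := by exact_mod_cast hθr i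
    have hs0 : 0 ≤ ((r i : ℝ) - θ i) / r i := div_nonneg (by linarith) (hr0 i).le
    have hs1 : ((r i : ℝ) - θ i) / r i ≤ 1 := by
      rw [div_le_one (hr0 i)]
      have : (0 : ℝ) ≤ θ i := Nat.cast_nonneg _
      linarith
    have e1 : ((r i : ℝ) - θ i) * k i * lp i =
        ((r i : ℝ) - θ i) / r i * (r i * lp i * k i) := by
      have := (hr0 i).ne'
      field_simp
    rw [e1]
    have h3 := mul_le_mul_of_nonneg_left (hk2 i) hs0
    have h4 := mul_le_mul_of_nonneg_right hs1 (mul_pos (hr0 i) (hlp0 i)).le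
    nlinarith
  have hsecond : (∑ a : (∀ i, Fin (k i) → ZMod (p i ^ r i)),
      if a = 0 then 0 else (2 : ℝ) ^ (-((n : ℝ) * (Inf (τ a) - δ (τ a))))) ≤
      ∑ θ ∈ T, K * ((2 : ℝ) ^ (-(δ θ))) ^ n := by
    calc _ ≤ ∑ a : (∀ i, Fin (k i) → ZMod (p i ^ r i)), ∑ θ ∈ T,
          (if τ a = θ then (2 : ℝ) ^ (-((n : ℝ) * (Inf θ - δ θ))) else 0) := by
          refine Finset.sum_le_sum fun a _ => ?_
          have hnn : ∀ θ ∈ T,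
              0 ≤ (if τ a = θ then (2 : ℝ) ^ (-((n : ℝ) * (Inf θ - δ θ))) else 0) := by
            intro θ _
            split_ifs <;> positivity
          by_cases ha : a = 0
          · rw [if_pos ha]; exact Finset.sum_nonneg hnn
          · rw [if_neg ha]
            have := Finset.single_le_sum hnn (hτT a ha)
            rwa [if_pos rfl] at this
      _ = ∑ θ ∈ T, ((Finset.univ.filter (fun a => τ a = θ)).card : ℝ) *
            (2 : ℝ) ^ (-((n : ℝ) * (Inf θ - δ θ))) := by
          rw [Finset.sum_comm]
          refine Finset.sum_congr rfl fun θ _ => ?_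
          rw [← Finset.sum_filter, Finset.sum_const, nsmul_eq_mul]
      _ ≤ _ := by
          refine Finset.sum_le_sum fun θ hθ => ?_
          refine (mul_le_mul_of_nonneg_right (hcount θ hθ) (by positivity)).trans ?_
          rw [mul_assoc, ← Real.rpow_add (by norm_num), ← Real.rpow_natCast,
            ← Real.rpow_mul (by norm_num)]
          refine mul_le_mul_of_nonneg_left
            (Real.rpow_le_rpow_of_exponent_le (by norm_num) (le_of_eq ?_)) hK0.le
          simp only [hδ]; ring
  have htot := hf.trans (add_le_add hfirst (le_trans
    (le_of_eq (Finset.sum_congr rfl fun a _ => by congr)) hsecond))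
  -- build the code
  let ι := (Fintype.equivFin (∀ i, Fin (k i) → ZMod (p i ^ r i))).symm
  let φ : (∀ i, Fin (k i) → ZMod (p i ^ r i)) →+ (Fin n → ∀ i, ZMod (p i ^ r i)) :=
    AddMonoidHom.pi (fun N => bil p r k (g N))
  refine ⟨Fintype.card (∀ i, Fin (k i) → ZMod (p i ^ r i)), φ.range, v,
    fun m => φ (ι m) + v, fun y => ι.symm (f y), ?_, ?_, ?_, ?_, ?_⟩
  · have hc : Fintype.card (∀ i, Fin (k i) → ZMod (p i ^ r i)) = ∏ i, p i ^ (r i * k i) := by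
      rw [Fintype.card_pi]
      refine Finset.prod_congr rfl fun i _ => ?_
      rw [Fintype.card_pi, Finset.prod_const, ZMod.card, Finset.card_univ, Fintype.card_fin, pow_mul]
    rw [hc, aux_pow p _ hp]
    refine Real.rpow_le_rpow_of_exponent_le (by norm_num) ?_
    have h1 : (n : ℝ) * R = ∑ i, (n : ℝ) * R * w i := by rw [← Finset.mul_sum, hw1, mul_one]
    have h2 : (n : ℝ) * (R - ε) ≤ n * R := by
      have : (0 : ℝ) ≤ n := Nat.cast_nonneg n
      nlinarith
    refine h2.trans ?_
    rw [h1]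
    refine Finset.sum_le_sum fun i _ => ?_
    have := hk1 i
    change _ ≤ ((r i * k i : ℕ) : ℝ) * lp i
    push_cast
    linarith
  · intro _ _ _; exact Set.mem_univ _
  · intro m; exact ⟨φ (ι m), ⟨ι m, rfl⟩, rfl⟩
  · rintro x ⟨c, ⟨j0, rfl⟩, rfl⟩
    have h1 : Nat.card {m // φ (ι m) + v = φ j0 + v} = Nat.card φ.ker := by
      refine Nat.card_congr ((ι.trans (Equiv.addRight (-j0))).subtypeEquiv fun m => ?_)
      simp [AddMonoidHom.mem_ker, add_neg_eq_zero]
    rw [h1, ← AddSubgroup.index_ker, AddSubgroup.card_mul_index, Nat.card_eq_fintype_card]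
  · refine le_trans (le_of_eq ?_) (htot.trans hsmall)
    unfold avgErr
    congr 1
    rw [← Equiv.sum_comp ι]
    refine Finset.sum_congr rfl fun m _ => Finset.sum_congr rfl fun y _ => ?_
    have : ι.symm (f y) ≠ m ↔ f y ≠ ι m := by rw [Ne, Equiv.symm_apply_eq]
    have h2 : Wn W (φ (ι m) + v) y = Wn W (fun N => bil p r k (g N) (ι m) + v N) y := rfl
    rw [h2]
    by_cases hy : f y ≠ ι m
    · rw [if_pos (this.2 hy), if_pos hy]
    · rw [if_neg (fun h => hy (this.1 h)), if_neg hy]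

/-- **Lower bound on the capacity of Abelian group codes** (Theorem 3.1).
For a DMC `(G, Y, W)` with `G = ⊕ᵢ ℤ_{pᵢ^{rᵢ}}`, the capacity `C_G` of shifted group
codes over `G` is at least
`sup_{w} min_{θ : H_θ ≠ {0}} (Σ_{S coset of H_θ} (|H_θ|/|G|) C^U_{|S|}) / w_{H_θ}`;
in particular, every rate strictly below this quantity is achievable using
shifted group codes over `G`. -/
theorem capacity_of_abelian_group_codes_lower_bound
    {I : ℕ} (p r : Fin I → ℕ) [∀ i, NeZero (p i ^ r i)]
    (hp : ∀ i, (p i).Prime) (hr : ∀ i, 0 < r i)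
    {Y : Type*} [Fintype Y] (W : (∀ i, ZMod (p i ^ r i)) → Y → ℝ)
    (hW0 : ∀ x y, 0 ≤ W x y) (hW1 : ∀ x, ∑ y, W x y = 1) :
    groupCodeLowerBound p r W ≤ capacity W Set.univ ∧
    ∀ R : ℝ, 0 ≤ R → R < groupCodeLowerBound p r W → achievable W Set.univ R := by
  have key : ∀ R : ℝ, 0 ≤ R → R < groupCodeLowerBound p r W → achievable W Set.univ R := by
    intro R hR hlt
    unfold groupCodeLowerBound at hlt
    set A := {x : ℝ | ∃ w : Fin I → ℝ, (∀ i, 0 ≤ w i) ∧ (∑ i, w i = 1) ∧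
      x = sInf {y : ℝ | ∃ θ : Fin I → ℕ, (∀ i, θ i ≤ r i) ∧ Htheta p r θ ≠ ⊥ ∧
      y = (∑ S ∈ cosetsOf (Htheta p r θ),
            ((Nat.card (Htheta p r θ) : ℝ) /
              (Fintype.card (∀ i, ZMod (p i ^ r i)) : ℝ)) * CU W S) /
          (∑ i, (((r i : ℝ) - (θ i : ℝ)) / (r i : ℝ)) * w i)}} with hA
    have hne : A.Nonempty := by
      rw [Set.nonempty_iff_ne_empty]
      intro h
      rw [h, Real.sSup_empty] at hlt
      linarith
    obtain ⟨x, ⟨w, hw0, hw1, rfl⟩, hx⟩ := exists_lt_of_lt_csSup hne hlt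
    refine aux_ach p r hp hr W hW0 hW1 R hR w hw0 hw1 fun θ hθ hbot => ?_
    have hbdd : BddBelow {y : ℝ | ∃ θ : Fin I → ℕ, (∀ i, θ i ≤ r i) ∧ Htheta p r θ ≠ ⊥ ∧
      y = (∑ S ∈ cosetsOf (Htheta p r θ),
            ((Nat.card (Htheta p r θ) : ℝ) /
              (Fintype.card (∀ i, ZMod (p i ^ r i)) : ℝ)) * CU W S) /
          (∑ i, (((r i : ℝ) - (θ i : ℝ)) / (r i : ℝ)) * w i)} := by
      by_contra h
      rw [Real.sInf_of_not_bddBelow h] at hx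
      linarith
    have h1 := hx.trans_le (csInf_le hbdd ⟨θ, hθ, hbot, rfl⟩)
    have hwn : 0 ≤ ∑ i, (((r i : ℝ) - (θ i : ℝ)) / (r i : ℝ)) * w i :=
      Finset.sum_nonneg fun i _ => by
        have : (θ i : ℝ) ≤ r i := by exact_mod_cast hθ i
        exact mul_nonneg (div_nonneg (by linarith) (Nat.cast_nonneg _)) (hw0 i)
    rcases hwn.eq_or_lt with h0 | h0
    · rw [← h0, div_zero] at h1
      linarith
    · rwa [lt_div_iff₀ h0] at h1
  refine ⟨?_, key⟩
  have hB : BddAbove {R : ℝ | achievable W Set.univ R} :=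
    ⟨_, fun R h => aux_bdd W hW0 hW1 R h⟩
  have hcap0 : 0 ≤ capacity W Set.univ := le_csSup hB (aux_zero W)
  refine le_of_forall_lt fun R hlt => ?_
  by_cases hR : R < 0
  · exact hR.trans_le hcap0
  · obtain ⟨R', h1, h2⟩ := exists_between hlt
    exact h1.trans_le (le_csSup hB (key R' (by linarith) h2))

end
end

section
/- Let q be a prime and let (ℤ_q, 𝒴, W) be a discrete memoryless channel whose input alphabet is the cyclic group (field) ℤ_q. Then the capacity of shifted group codes (linear/affine codes) over ℤ_q equals C^U_{|ℤ_q|}, i.e. the mutual information I(X;Y) between the channel input X uniformly distributed on ℤ_q and the channel output Y. -/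
open scoped BigOperators Classical

noncomputable section

def kl1 {Y : Type*} [Fintype Y] (w s : Y → ℝ) : ℝ := ∑ y, w y * Real.log (w y / s y)

lemma log_pt {a b c : ℝ} (ha : 0 ≤ a) (hb : 0 ≤ b) (hc : 0 < c) (hab : b = 0 → a = 0) :
    a * Real.log c + a - b * c ≤ a * Real.log (a / b) := by
  rcases ha.eq_or_lt with h | h
  · subst h; simp; positivity
  · have hb' : 0 < b := lt_of_le_of_ne hb (fun h' => h.ne' (hab h'.symm))
    have h1 := Real.log_le_sub_one_of_pos (show 0 < b * c / a by positivity)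
    rw [Real.log_div (by positivity) h.ne', Real.log_mul hb'.ne' hc.ne'] at h1
    rw [Real.log_div h.ne' hb'.ne']
    have h2 := mul_le_mul_of_nonneg_left h1 h.le
    have h3 : a * (b * c / a - 1) = b * c - a := by field_simp
    rw [h3] at h2
    linarith

lemma kl1_nonneg {Y : Type*} [Fintype Y] (w s : Y → ℝ) (hw : ∀ y, 0 ≤ w y) (hs : ∀ y, 0 ≤ s y)
    (hws : ∀ y, s y = 0 → w y = 0) (h1 : ∑ y, w y = 1) (h2 : ∑ y, s y = 1) : 0 ≤ kl1 w s := by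
  have : ∑ y, (w y - s y) ≤ kl1 w s := by
    apply Finset.sum_le_sum
    intro y _
    have := log_pt (hw y) (hs y) one_pos (hws y)
    simpa using this
  rw [Finset.sum_sub_distrib, h1, h2] at this
  linarith

lemma sum_prod_one {Y : Type*} [Fintype Y] {n : ℕ} (w : Fin n → Y → ℝ)
    (hw : ∀ i, ∑ y, w i y = 1) : ∑ y : Fin n → Y, ∏ i, w i (y i) = 1 := by
  rw [← Fintype.prod_sum]; simp [hw]

lemma sum_prod_single {Y : Type*} [Fintype Y] {n : ℕ} (w : Fin n → Y → ℝ)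
    (hw : ∀ i, ∑ y, w i y = 1) (i : Fin n) (h : Y → ℝ) :
    ∑ y : Fin n → Y, (∏ j, w j (y j)) * h (y i) = ∑ y, w i y * h y := by
  have : ∀ y : Fin n → Y, (∏ j, w j (y j)) * h (y i)
      = ∏ j, (w j (y j) * if j = i then h (y j) else 1) := by
    intro y
    rw [Finset.prod_mul_distrib]
    simp
  simp_rw [this]
  rw [← Fintype.prod_sum (f := fun j y => w j y * if j = i then h y else 1)]
  rw [Finset.prod_eq_single i]
  · simp
  · intro j _ hj
    simp [hj, hw]
  · simp

lemma kl_prod {Y : Type*} [Fintype Y] {n : ℕ} (w s : Fin n → Y → ℝ)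
    (hw : ∀ i, ∑ y, w i y = 1) (hws : ∀ i y, s i y = 0 → w i y = 0) :
    ∑ y : Fin n → Y, (∏ j, w j (y j)) * Real.log ((∏ j, w j (y j)) / (∏ j, s j (y j)))
      = ∑ i, kl1 (w i) (s i) := by
  have : ∀ y : Fin n → Y, (∏ j, w j (y j)) * Real.log ((∏ j, w j (y j)) / (∏ j, s j (y j)))
      = ∑ i, (∏ j, w j (y j)) * Real.log (w i (y i) / s i (y i)) := by
    intro y
    by_cases h0 : ∏ j, w j (y j) = 0
    · simp [h0]
    · rw [← Finset.mul_sum, ← Finset.prod_div_distrib, Real.log_prod]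
      intro i _
      have := Finset.prod_ne_zero_iff.1 h0 i (Finset.mem_univ _)
      exact div_ne_zero this (fun h => this (hws _ _ h))
  simp_rw [this]
  rw [Finset.sum_comm]
  refine Finset.sum_congr rfl fun i _ => ?_
  exact sum_prod_single w hw i (fun y => Real.log (w i y / s i y))

lemma fano {G Y : Type*} [Fintype Y] (W : G → Y → ℝ)
    (hW0 : ∀ x y, 0 ≤ W x y) (hW1 : ∀ x, ∑ y, W x y = 1) {n M : ℕ} (hM : 0 < M)
    (e : Fin M → Fin n → G) (f : (Fin n → Y) → Fin M) (s : Fin n → Y → ℝ)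
    (hs0 : ∀ i y, 0 ≤ s i y) (hs1 : ∀ i, ∑ y, s i y = 1)
    (hws : ∀ m i y, s i y = 0 → W (e m i) y = 0) :
    (1 - avgErr W e f) * Real.log M - Real.log 2 ≤
      (M : ℝ)⁻¹ * ∑ m, ∑ i, kl1 (W (e m i)) (s i) := by
  have hMr : (0 : ℝ) < M := by exact_mod_cast hM
  set c : Fin M → (Fin n → Y) → ℝ := fun m y => (if f y ≠ m then 1 else (M : ℝ)) / 2 with hc
  have hcpos : ∀ m y, 0 < c m y := by
    intro m y; simp only [hc]; split_ifs <;> positivity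
  have hS : ∑ y : Fin n → Y, ∏ i, s i (y i) = 1 := sum_prod_one s hs1
  have hWn1 : ∀ m, ∑ y : Fin n → Y, Wn W (e m) y = 1 := fun m =>
    sum_prod_one (fun i => W (e m i)) (fun i => hW1 _)
  have hlogc : ∀ m y, Real.log (c m y)
      = Real.log M - Real.log 2 - (if f y ≠ m then 1 else 0) * Real.log M := by
    intro m y; simp only [hc]
    split_ifs
    · rw [Real.log_div] <;> simp
    · rw [Real.log_div hMr.ne' (by norm_num)]; simp
  have key : ∀ m, ∑ y, (Wn W (e m) y * Real.log (c m y) + Wn W (e m) y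
      - (∏ i, s i (y i)) * c m y) ≤ ∑ i, kl1 (W (e m i)) (s i) := by
    intro m
    rw [← kl_prod (fun i => W (e m i)) s (fun i => hW1 _) (hws m)]
    refine Finset.sum_le_sum fun y _ => ?_
    refine log_pt (Finset.prod_nonneg fun i _ => hW0 _ _) (Finset.prod_nonneg fun i _ => hs0 _ _)
      (hcpos m y) ?_
    intro h
    obtain ⟨i, _, hi⟩ := Finset.prod_eq_zero_iff.1 h
    exact Finset.prod_eq_zero (Finset.mem_univ i) (hws m i _ hi)
  have key2 := Finset.sum_le_sum (s := Finset.univ) fun m _ => key m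
  have e1 : ∑ m, ∑ y, (Wn W (e m) y * Real.log (c m y) + Wn W (e m) y
      - (∏ i, s i (y i)) * c m y) =
      M * (Real.log M - Real.log 2) - M * avgErr W e f * Real.log M + M
        - ∑ y, (∏ i, s i (y i)) * ∑ m, c m y := by
    have : ∀ m y, Wn W (e m) y * Real.log (c m y) + Wn W (e m) y - (∏ i, s i (y i)) * c m y
      = Wn W (e m) y * (Real.log M - Real.log 2 + 1)
        - (if f y ≠ m then Wn W (e m) y else 0) * Real.log M - (∏ i, s i (y i)) * c m y := by
      intro m y
      rw [hlogc]; split_ifs <;> ring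
    simp_rw [this, Finset.sum_sub_distrib, ← Finset.sum_mul, hWn1]
    rw [Finset.sum_comm (f := fun m y => (∏ i, s i (y i)) * c m y)]
    simp_rw [← Finset.mul_sum]
    unfold avgErr
    rw [← mul_assoc, mul_inv_cancel₀ hMr.ne']
    simp
    ring
  have e2 : ∑ y, (∏ i, s i (y i)) * ∑ m, c m y ≤ M := by
    have : ∀ y, ∑ m, c m y ≤ M := by
      intro y
      simp only [hc]
      rw [← Finset.sum_div]
      have h1 : ∑ m : Fin M, (if f y ≠ m then (1 : ℝ) else M) ≤
          ∑ m : Fin M, ((1 : ℝ) + if f y = m then (M : ℝ) else 0) := by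
        refine Finset.sum_le_sum fun m _ => ?_
        by_cases h : f y = m <;> simp [h]
      rw [Finset.sum_add_distrib] at h1
      simp at h1
      simp
      linarith
    calc _ ≤ ∑ y, (∏ i, s i (y i)) * (M : ℝ) := Finset.sum_le_sum fun y _ =>
          mul_le_mul_of_nonneg_left (this y) (Finset.prod_nonneg fun i _ => hs0 _ _)
      _ = M := by rw [← Finset.sum_mul, hS, one_mul]
  rw [e1] at key2
  rw [le_inv_mul_iff₀ hMr]
  linarith

/-- output distribution under uniform input -/
def outP {q : ℕ} [NeZero q] {Y : Type*} (W : ZMod q → Y → ℝ) (y : Y) : ℝ :=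
  ∑ x, (q : ℝ)⁻¹ * W x y

lemma CU_eq {q : ℕ} [NeZero q] {Y : Type*} [Fintype Y] (W : ZMod q → Y → ℝ) :
    CU W Finset.univ * Real.log 2 = (q : ℝ)⁻¹ * ∑ x, kl1 (W x) (outP W) := by
  have hq : (q : ℝ) ≠ 0 := by exact_mod_cast NeZero.ne q
  unfold CU mutualInfo kl1
  simp only [Finset.mem_univ, if_true, Finset.card_univ, ZMod.card]
  rw [Finset.sum_mul, Finset.mul_sum]
  refine Finset.sum_congr rfl fun x _ => ?_
  rw [Finset.sum_mul, Finset.mul_sum]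
  refine Finset.sum_congr rfl fun y _ => ?_
  rw [mul_div_mul_left _ _ (inv_ne_zero hq), Real.logb]
  have : Real.log 2 ≠ 0 := (Real.log_pos (by norm_num)).ne'
  change _ * (_ / _) * _ = _ * (_ * Real.log (W x y / ∑ x, (q : ℝ)⁻¹ * W x y))
  field_simp

section
variable {q : ℕ} [NeZero q] {Y : Type*} [Fintype Y] (W : ZMod q → Y → ℝ)

set_option linter.unusedSectionVars false
lemma outP_nonneg (hW0 : ∀ x y, 0 ≤ W x y) (y : Y) : 0 ≤ outP W y :=
  Finset.sum_nonneg fun x _ => mul_nonneg (by positivity) (hW0 _ _)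

lemma outP_sum (hW1 : ∀ x, ∑ y, W x y = 1) : ∑ y, outP W y = 1 := by
  have hq : (q : ℝ) ≠ 0 := by exact_mod_cast NeZero.ne q
  unfold outP
  rw [Finset.sum_comm]
  simp_rw [← Finset.mul_sum, hW1]
  simp [ZMod.card, hq]

lemma outP_zero (hW0 : ∀ x y, 0 ≤ W x y) (x : ZMod q) (y : Y) (h : outP W y = 0) : W x y = 0 := by
  have hq : (q : ℝ) ≠ 0 := by exact_mod_cast NeZero.ne q
  have := (Finset.sum_eq_zero_iff_of_nonneg
    (fun x _ => mul_nonneg (by positivity) (hW0 x y))).1 h x (Finset.mem_univ _)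
  simpa [hq] using this

lemma CU_nonneg (hW0 : ∀ x y, 0 ≤ W x y) (hW1 : ∀ x, ∑ y, W x y = 1) :
    0 ≤ CU W Finset.univ * Real.log 2 := by
  rw [CU_eq]
  refine mul_nonneg (by positivity) (Finset.sum_nonneg fun x _ => ?_)
  exact kl1_nonneg _ _ (hW0 x) (outP_nonneg W hW0) (outP_zero W hW0 x) (hW1 x) (outP_sum W hW1)

lemma sum_coset {n M : ℕ} (C : AddSubgroup (Fin n → ZMod q)) (v : Fin n → ZMod q)
    (e : Fin M → Fin n → ZMod q)
    (h1 : ∀ m, e m ∈ {x | ∃ c ∈ C, x = c + v})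
    (h2 : ∀ x ∈ {x : Fin n → ZMod q | ∃ c ∈ C, x = c + v},
        Nat.card {m : Fin M // e m = x} * Nat.card C = M) (H : (Fin n → ZMod q) → ℝ) :
    (Nat.card C : ℝ) * ∑ m, H (e m) = M * ∑ c : C, H (c + v) := by
  have : ∀ m, H (e m) = ∑ c : C, if e m = c + v then H (c + v) else 0 := by
    intro m
    obtain ⟨c, hc, hx⟩ := h1 m
    rw [Finset.sum_eq_single ⟨c, hc⟩]
    · simp [hx]
    · intro b _ hb
      rw [if_neg]
      intro h
      apply hb
      ext1
      exact add_right_cancel (h.symm.trans hx)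
    · simp
  simp_rw [this]
  rw [Finset.sum_comm, Finset.mul_sum, Finset.mul_sum]
  refine Finset.sum_congr rfl fun c _ => ?_
  have h := h2 (c + v) ⟨c, c.2, rfl⟩
  rw [← Finset.sum_filter, Finset.sum_const, nsmul_eq_mul, ← mul_assoc]
  congr 1
  rw [Nat.card_eq_fintype_card (α := {m // e m = c + v}), Fintype.card_subtype] at h
  rw [mul_comm]
  exact_mod_cast h

lemma sum_coord (hq : q.Prime) {n : ℕ} (C : AddSubgroup (Fin n → ZMod q)) (v : Fin n → ZMod q)
    (i : Fin n) (c : Fin n → ZMod q) (hc : c ∈ C) (hci : c i ≠ 0) (h : ZMod q → ℝ) :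
    (q : ℝ) * ∑ c : C, h (c.1 i + v i) = (Nat.card C : ℝ) * ∑ g, h g := by
  have : Fact q.Prime := ⟨hq⟩
  have hg : ∀ g : ZMod q, ∃ d : C, d.1 i = g := by
    intro g
    refine ⟨⟨(g * (c i)⁻¹).val • c, C.nsmul_mem hc _⟩, ?_⟩
    simp [hci]
  have h1 : ∀ g : ZMod q, ∑ c : C, h (c.1 i + v i) = ∑ c : C, h (c.1 i + g + v i) := by
    intro g
    obtain ⟨d, hd⟩ := hg g
    rw [← Equiv.sum_comp (Equiv.addRight d)]
    simp [hd]
  calc (q : ℝ) * ∑ c : C, h (c.1 i + v i) = ∑ g : ZMod q, ∑ c : C, h (c.1 i + v i) := by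
        simp [ZMod.card]
    _ = ∑ g : ZMod q, ∑ c : C, h (c.1 i + g + v i) := Finset.sum_congr rfl fun g _ => h1 g
    _ = ∑ c : C, ∑ g : ZMod q, h (c.1 i + g + v i) := Finset.sum_comm
    _ = ∑ c : C, ∑ g : ZMod q, h g := by
        refine Finset.sum_congr rfl fun c _ => ?_
        rw [← Equiv.sum_comp (Equiv.addRight (c.1 i + v i)) h]
        refine Finset.sum_congr rfl fun g _ => ?_
        congr 1
        simp; ring
    _ = _ := by simp [Nat.card_eq_fintype_card]

lemma converse (hq : q.Prime) (hW0 : ∀ x y, 0 ≤ W x y) (hW1 : ∀ x, ∑ y, W x y = 1)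
    (R : ℝ) (hR : achievable W Set.univ R) : R ≤ CU W Finset.univ := by
  have hl2 : 0 < Real.log 2 := Real.log_pos (by norm_num)
  have hCn := CU_nonneg W hW0 hW1
  have hC0 : 0 ≤ CU W Finset.univ := nonneg_of_mul_nonneg_left hCn hl2
  have hqr : (0 : ℝ) < q := by exact_mod_cast hq.pos
  by_contra! hlt
  obtain ⟨hR0, hA⟩ := hR
  set C0 := CU W Finset.univ with hC0def
  set δ := R - C0 with hδ
  have hδ0 : 0 < δ := by simp [hδ, hlt]
  obtain ⟨n₀, hn₀⟩ := hA (min (1/2) (δ / (2 * (1 + R)))) (by positivity)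
  set ε := min (1/2) (δ / (2 * (1 + R))) with hε
  have hε0 : 0 < ε := by positivity
  have hε1 : ε ≤ 1/2 := min_le_left _ _
  have hε2 : ε * (1 + R) ≤ δ / 2 := by
    calc ε * (1 + R) ≤ δ / (2 * (1 + R)) * (1 + R) :=
          mul_le_mul_of_nonneg_right (min_le_right _ _) (by positivity)
      _ = δ / 2 := by field_simp
  obtain ⟨n, hn⟩ := exists_nat_gt (max (n₀ : ℝ) (2 / δ))
  have hn1 : n₀ ≤ n := by
    have := (le_max_left _ _).trans_lt hn
    exact_mod_cast this.le
  have hn2 : 2 / δ < n := (le_max_right _ _).trans_lt hn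
  obtain ⟨M, C, v, e, f, hM, -, h1, h2, herr⟩ := hn₀ n hn1
  have hMr : (0 : ℝ) < M := lt_of_lt_of_le (by positivity) hM
  have hM0 : 0 < M := by exact_mod_cast hMr
  have hlogM : (n : ℝ) * (R - ε) * Real.log 2 ≤ Real.log M := by
    rw [← Real.log_rpow (by norm_num)]
    exact Real.log_le_log (by positivity) hM
  have hlogM0 : 0 ≤ Real.log M := Real.log_natCast_nonneg M
  set s : Fin n → Y → ℝ := fun i => if ∀ c ∈ C, c i = 0 then W (v i) else outP W with hs
  have F := fano W hW0 hW1 hM0 e f s ?_ ?_ ?_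
  rotate_left
  · intro i y; simp only [hs]; split_ifs
    exacts [hW0 _ _, outP_nonneg W hW0 y]
  · intro i; simp only [hs]; split_ifs
    exacts [hW1 _, outP_sum W hW1]
  · intro m i y; simp only [hs]; split_ifs with h
    · obtain ⟨c, hc, hx⟩ := h1 m
      simp [hx, h c hc]
    · exact outP_zero W hW0 _ y
  have hcoord : ∀ i, ∑ m, kl1 (W (e m i)) (s i) ≤ M * (C0 * Real.log 2) := by
    intro i
    by_cases h : ∀ c ∈ C, c i = 0
    · have : ∀ m, kl1 (W (e m i)) (s i) = 0 := by
        intro m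
        obtain ⟨c, hc, hx⟩ := h1 m
        have : e m i = v i := by simp [hx, h c hc]
        have h' : s i = W (v i) := by simp only [hs]; rw [if_pos h]
        rw [h', this]
        unfold kl1
        refine Finset.sum_eq_zero fun y _ => ?_
        by_cases h0 : W (v i) y = 0 <;> simp [h0]
      simp only [this, Finset.sum_const_zero]
      positivity
    · have h' : s i = outP W := by simp only [hs]; rw [if_neg h]
      rw [h', hC0def, CU_eq]
      push Not at h
      obtain ⟨c, hc, hci⟩ := h
      have a1 := sum_coset C v e h1 h2 (fun x => kl1 (W (x i)) (outP W))
      have a2 := sum_coord hq C v i c hc hci (fun g => kl1 (W g) (outP W))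
      have hcard : (0 : ℝ) < Nat.card C := by exact_mod_cast Nat.card_pos
      simp only [Pi.add_apply] at a1
      apply le_of_eq
      apply mul_left_cancel₀ hcard.ne'
      rw [a1]
      apply mul_left_cancel₀ hqr.ne'
      rw [mul_left_comm, a2]
      field_simp
  have hsum : (M : ℝ)⁻¹ * ∑ m, ∑ i, kl1 (W (e m i)) (s i) ≤ n * (C0 * Real.log 2) := by
    rw [inv_mul_le_iff₀ hMr, Finset.sum_comm]
    calc _ ≤ ∑ i : Fin n, (M : ℝ) * (C0 * Real.log 2) := Finset.sum_le_sum fun i _ => hcoord i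
      _ = _ := by simp; ring
  have g1 : (1 - ε) * Real.log M ≤ (1 - avgErr W e f) * Real.log M :=
    mul_le_mul_of_nonneg_right (by linarith) hlogM0
  have g2 : (1 - ε) * ((n : ℝ) * (R - ε) * Real.log 2) ≤ (1 - ε) * Real.log M :=
    mul_le_mul_of_nonneg_left hlogM (by linarith)
  have g3 : ((1 - ε) * (n * (R - ε))) * Real.log 2 ≤ (1 + n * C0) * Real.log 2 := by
    linarith
  have g4 := le_of_mul_le_mul_right g3 hl2
  have g5 : (n : ℝ) * (C0 + δ / 2) ≤ n * ((1 - ε) * (R - ε)) := by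
    apply mul_le_mul_of_nonneg_left _ (by positivity)
    nlinarith
  have g6 : 2 < n * δ := by rwa [div_lt_iff₀ hδ0] at hn2
  nlinarith

end

section
variable {q : ℕ} [NeZero q] {Y : Type*} [Fintype Y] (W : ZMod q → Y → ℝ)

lemma chernoff (hW1 : ∀ x, ∑ y, W x y = 1) (t : ℝ) (ht : t < CU W Finset.univ * Real.log 2) :
    ∃ s : ℝ, 0 < s ∧
      ∑ x, ∑ y, (q : ℝ)⁻¹ * W x y * Real.exp (s * (t - Real.log (W x y / outP W y))) < 1 := by
  have hq : (q : ℝ) ≠ 0 := by exact_mod_cast NeZero.ne q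
  set g : ℝ → ℝ := fun s =>
    ∑ x, ∑ y, (q : ℝ)⁻¹ * W x y * Real.exp (s * (t - Real.log (W x y / outP W y))) with hg
  have hone : ∑ x : ZMod q, ∑ y, (q : ℝ)⁻¹ * W x y = 1 := by
    simp_rw [← Finset.mul_sum, hW1]; simp [ZMod.card, hq]
  have g0 : g 0 = 1 := by simpa [hg] using hone
  have hd : HasDerivAt g (∑ x, ∑ y, (q : ℝ)⁻¹ * W x y *
      (Real.exp (0 * (t - Real.log (W x y / outP W y))) *
        (1 * (t - Real.log (W x y / outP W y))))) 0 := by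
    refine HasDerivAt.fun_sum fun x _ => HasDerivAt.fun_sum fun y _ => ?_
    exact (((hasDerivAt_id (0 : ℝ)).mul_const _).exp).const_mul _
  have hval : (∑ x, ∑ y, (q : ℝ)⁻¹ * W x y *
      (Real.exp (0 * (t - Real.log (W x y / outP W y))) *
        (1 * (t - Real.log (W x y / outP W y))))) = t - CU W Finset.univ * Real.log 2 := by
    rw [CU_eq]
    simp only [zero_mul, Real.exp_zero, one_mul]
    simp only [mul_sub, Finset.sum_sub_distrib, ← Finset.sum_mul, hone, one_mul, kl1]
    simp only [Finset.mul_sum, mul_assoc]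
  rw [hval] at hd
  have hd' := (hd.hasDerivWithinAt (s := Set.Ioi 0))
  rw [hasDerivWithinAt_iff_tendsto_slope' (by simp)] at hd'
  have hev := hd'.eventually (gt_mem_nhds (show t - CU W Finset.univ * Real.log 2 < 0 by linarith))
  obtain ⟨s, hs1, hs2⟩ := (hev.and self_mem_nhdsWithin).exists
  refine ⟨s, hs2, ?_⟩
  have hs2' : 0 < s := hs2
  rw [slope_def_field, sub_zero, div_lt_iff₀ hs2', g0] at hs1
  change g s < 1
  linarith

def Pn {n : ℕ} (y : Fin n → Y) : ℝ := ∏ i, outP W (y i)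

lemma sum_Wn {n : ℕ} (y : Fin n → Y) :
    ∑ x : Fin n → ZMod q, Wn W x y = (q : ℝ) ^ n * Pn W y := by
  have hq : (q : ℝ) ≠ 0 := by exact_mod_cast NeZero.ne q
  unfold Wn Pn
  rw [← Fintype.prod_sum (f := fun i x => W x (y i))]
  have : ∀ i, ∑ x, W x (y i) = q * outP W (y i) := by
    intro i; unfold outP; rw [← Finset.mul_sum, mul_inv_cancel_left₀ hq]
  simp_rw [this, Finset.prod_mul_distrib]
  simp

lemma badsum (hW0 : ∀ x y, 0 ≤ W x y) (t s : ℝ) (hs : 0 < s) (n : ℕ) :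
    ∑ x : Fin n → ZMod q, ∑ y : Fin n → Y,
      (if Wn W x y ≤ Real.exp (n * t) * Pn W y then Wn W x y else 0) ≤ (q : ℝ) ^ n *
      (∑ x, ∑ y, (q : ℝ)⁻¹ * W x y * Real.exp (s * (t - Real.log (W x y / outP W y)))) ^ n := by
  have hq : (q : ℝ) ≠ 0 := by exact_mod_cast NeZero.ne q
  have hr : (q : ℝ) ^ n *
      (∑ x, ∑ y, (q : ℝ)⁻¹ * W x y * Real.exp (s * (t - Real.log (W x y / outP W y)))) ^ n
      = ∑ x : Fin n → ZMod q, ∑ y : Fin n → Y,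
        ∏ i, (W (x i) (y i) * Real.exp (s * (t - Real.log (W (x i) (y i) / outP W (y i))))) := by
    have : ∀ x : Fin n → ZMod q, ∑ y : Fin n → Y,
        ∏ i, (W (x i) (y i) * Real.exp (s * (t - Real.log (W (x i) (y i) / outP W (y i)))))
        = ∏ i, ∑ y, (W (x i) y * Real.exp (s * (t - Real.log (W (x i) y / outP W y)))) :=
      fun x => (Fintype.prod_sum (f := fun i y =>
        (W (x i) y * Real.exp (s * (t - Real.log (W (x i) y / outP W y)))))).symm
    simp_rw [this]
    rw [← Fintype.prod_sum (f := fun (_ : Fin n) x => ∑ y, (W x y * Real.exp (s * (t - Real.log (W x y / outP W y)))))]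
    rw [← mul_pow, Finset.prod_const, Finset.card_univ, Fintype.card_fin]
    congr 1
    simp_rw [Finset.mul_sum, mul_assoc, mul_inv_cancel_left₀ hq]
  rw [hr]
  refine Finset.sum_le_sum fun x _ => Finset.sum_le_sum fun y _ => ?_
  have hnn : 0 ≤ ∏ i, (W (x i) (y i) *
      Real.exp (s * (t - Real.log (W (x i) (y i) / outP W (y i))))) :=
    Finset.prod_nonneg fun i _ => mul_nonneg (hW0 _ _) (Real.exp_pos _).le
  split_ifs with h
  swap
  · exact hnn
  by_cases h0 : Wn W x y = 0
  · rw [h0]; exact hnn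
  have hne : ∀ i, W (x i) (y i) ≠ 0 := fun i => Finset.prod_ne_zero_iff.1 h0 i (Finset.mem_univ _)
  have hPpos : ∀ i, 0 < outP W (y i) := fun i =>
    lt_of_le_of_ne (outP_nonneg W hW0 _) (fun h => hne i (outP_zero W hW0 _ _ h.symm))
  have hWpos : ∀ i, 0 < W (x i) (y i) := fun i => lt_of_le_of_ne (hW0 _ _) (hne i).symm
  rw [Finset.prod_mul_distrib]
  refine le_mul_of_one_le_right (Finset.prod_nonneg fun i _ => hW0 _ _) ?_
  rw [← Real.exp_sum, ← Finset.mul_sum, Finset.sum_sub_distrib, ← Real.log_prod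
    (fun i _ => (div_pos (hWpos i) (hPpos i)).ne'), Finset.prod_div_distrib]
  apply Real.one_le_exp
  refine mul_nonneg hs.le ?_
  have hPn : 0 < ∏ i, outP W (y i) := Finset.prod_pos fun i _ => hPpos i
  have hWp : 0 < ∏ i, W (x i) (y i) := Finset.prod_pos fun i _ => hWpos i
  have : Real.log ((∏ i, W (x i) (y i)) / ∏ i, outP W (y i)) ≤ n * t := by
    rw [Real.log_le_iff_le_exp (div_pos hWp hPn), div_le_iff₀ hPn]
    exact h
  simpa using this

open Matrix in
lemma sum_mat (hq : q.Prime) {k n : ℕ} (d : Fin k → ZMod q) (hd : d ≠ 0)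
    (h : (Fin n → ZMod q) → ℝ) :
    (q : ℝ) ^ n * ∑ A : Matrix (Fin k) (Fin n) (ZMod q), h (d ᵥ* A)
      = (Fintype.card (Matrix (Fin k) (Fin n) (ZMod q)) : ℝ) * ∑ w, h w := by
  have : Fact q.Prime := ⟨hq⟩
  obtain ⟨i, hi⟩ := Function.ne_iff.1 hd
  have hi' : d i ≠ 0 := hi
  have hw : ∀ w : Fin n → ZMod q, ∃ B : Matrix (Fin k) (Fin n) (ZMod q), d ᵥ* B = w := by
    intro w
    refine ⟨Matrix.of fun a b => if a = i then (d i)⁻¹ * w b else 0, ?_⟩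
    ext b
    simp [Matrix.vecMul, dotProduct, hi']
  have h1 : ∀ w : Fin n → ZMod q, ∑ A : Matrix (Fin k) (Fin n) (ZMod q), h (d ᵥ* A)
      = ∑ A : Matrix (Fin k) (Fin n) (ZMod q), h (d ᵥ* A + w) := by
    intro w
    obtain ⟨B, hB⟩ := hw w
    rw [← Equiv.sum_comp (Equiv.addRight B)]
    simp [Matrix.vecMul_add, hB]
  calc _ = ∑ w : Fin n → ZMod q, ∑ A : Matrix (Fin k) (Fin n) (ZMod q), h (d ᵥ* A) := by
        simp [ZMod.card]
    _ = ∑ w : Fin n → ZMod q, ∑ A : Matrix (Fin k) (Fin n) (ZMod q), h (d ᵥ* A + w) :=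
        Finset.sum_congr rfl fun w _ => h1 w
    _ = ∑ A : Matrix (Fin k) (Fin n) (ZMod q), ∑ w : Fin n → ZMod q, h (d ᵥ* A + w) :=
        Finset.sum_comm
    _ = ∑ A : Matrix (Fin k) (Fin n) (ZMod q), ∑ w : Fin n → ZMod q, h w := by
        refine Finset.sum_congr rfl fun A _ => ?_
        exact Equiv.sum_comp (Equiv.addLeft (d ᵥ* A)) h
    _ = _ := by rw [Finset.sum_const, nsmul_eq_mul, Finset.card_univ]

lemma dec_exists {U : Type*} [Fintype U] [DecidableEq U] [Nonempty U] (hW0 : ∀ x y, 0 ≤ W x y) {n : ℕ} (T : ℝ)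
    (e : U → Fin n → ZMod q) :
    ∃ f : (Fin n → Y) → U, ∑ u, ∑ y, (if f y ≠ u then Wn W (e u) y else 0) ≤
      ∑ u, ∑ y, (if Wn W (e u) y ≤ T * Pn W y then Wn W (e u) y else 0) +
      ∑ u, ∑ u', if u' ≠ u then
        ∑ y, (if T * Pn W y < Wn W (e u') y then Wn W (e u) y else 0) else 0 := by
  have hF : ∀ y : Fin n → Y, ∃ z : U, (∃ u, T * Pn W y < Wn W (e u) y) →
      T * Pn W y < Wn W (e z) y := by
    intro y
    by_cases h : ∃ u, T * Pn W y < Wn W (e u) y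
    · exact ⟨h.choose, fun _ => h.choose_spec⟩
    · exact ⟨Classical.arbitrary U, fun h' => absurd h' h⟩
  choose F hF using hF
  refine ⟨F, ?_⟩
  rw [← Finset.sum_add_distrib]
  refine Finset.sum_le_sum fun u _ => ?_
  have hnn : ∀ x (y : Fin n → Y), 0 ≤ Wn W x y := fun x y => Finset.prod_nonneg fun i _ => hW0 _ _
  have : ∀ u', (if u' ≠ u then
        ∑ y, (if T * Pn W y < Wn W (e u') y then Wn W (e u) y else 0) else 0)
      = ∑ y, if u' ≠ u ∧ T * Pn W y < Wn W (e u') y then Wn W (e u) y else 0 := by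
    intro u'
    by_cases h : u' = u <;> simp [h]
  simp_rw [this]
  rw [Finset.sum_comm, ← Finset.sum_add_distrib]
  refine Finset.sum_le_sum fun y _ => ?_
  have n1 : 0 ≤ (if Wn W (e u) y ≤ T * Pn W y then Wn W (e u) y else 0) := by
    split_ifs; exacts [hnn _ _, le_rfl]
  have n2 : ∀ u', 0 ≤ (if u' ≠ u ∧ T * Pn W y < Wn W (e u') y then Wn W (e u) y else 0) := by
    intro u'
    split_ifs; exacts [hnn _ _, le_rfl]
  have n3 := Finset.sum_nonneg fun u' (_ : u' ∈ Finset.univ) => n2 u'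
  by_cases hb : Wn W (e u) y ≤ T * Pn W y
  · rw [if_pos hb]
    refine le_trans ?_ (le_add_of_nonneg_right n3)
    split_ifs; exacts [le_rfl, hnn _ _]
  · have hex : ∃ u, T * Pn W y < Wn W (e u) y := ⟨u, not_le.1 hb⟩
    by_cases hu : F y = u
    · rw [if_neg (by simpa using hu)]
      exact add_nonneg n1 n3
    · rw [if_pos hu]
      refine le_trans ?_ (le_add_of_nonneg_left n1)
      refine le_trans ?_ (Finset.single_le_sum (fun u' _ => n2 u') (Finset.mem_univ (F y)))
      rw [if_pos ⟨hu, hF y hex⟩]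

open Matrix in
lemma random_coding (hq : q.Prime) (hW0 : ∀ x y, 0 ≤ W x y) (hW1 : ∀ x, ∑ y, W x y = 1)
    (k n : ℕ) (T B : ℝ) (hT : 0 < T)
    (hB : ∑ x : Fin n → ZMod q, ∑ y : Fin n → Y,
      (if Wn W x y ≤ T * Pn W y then Wn W x y else 0) ≤ (q : ℝ) ^ n * B) :
    ∃ (A : Matrix (Fin k) (Fin n) (ZMod q)) (v : Fin n → ZMod q)
      (f : (Fin n → Y) → (Fin k → ZMod q)),
      ∑ u, ∑ y, (if f y ≠ u then Wn W (u ᵥ* A + v) y else 0) ≤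
        (q : ℝ) ^ k * (B + ((q : ℝ) ^ k - 1) / T) := by
  have hqr : (0 : ℝ) < q := by exact_mod_cast hq.pos
  have hnn : ∀ x (y : Fin n → Y), 0 ≤ Wn W x y := fun x y => Finset.prod_nonneg fun i _ => hW0 _ _
  set E1 : (Fin n → ZMod q) → ℝ := fun x => ∑ y : Fin n → Y,
    (if Wn W x y ≤ T * Pn W y then Wn W x y else 0) with hE1
  set E2 : (Fin n → ZMod q) → (Fin n → ZMod q) → ℝ := fun x x' => ∑ y : Fin n → Y,
    (if T * Pn W y < Wn W x' y then Wn W x y else 0) with hE2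
  set N : ℝ := (Fintype.card (Matrix (Fin k) (Fin n) (ZMod q)) : ℝ) with hN
  have hE2sum : ∑ x, ∑ x', E2 x x' ≤ (q : ℝ) ^ n * ((q : ℝ) ^ n / T) := by
    have : ∑ x, ∑ x', E2 x x' = ∑ x', ∑ y : Fin n → Y,
        (if T * Pn W y < Wn W x' y then (q : ℝ) ^ n * Pn W y else 0) := by
      rw [Finset.sum_comm]
      refine Finset.sum_congr rfl fun x' _ => ?_
      simp only [hE2]
      rw [Finset.sum_comm]
      refine Finset.sum_congr rfl fun y _ => ?_
      split_ifs
      · exact sum_Wn W y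
      · simp
    rw [this]
    have h2 : ∑ x' : Fin n → ZMod q, ∑ y : Fin n → Y, (q : ℝ) ^ n * (Wn W x' y / T)
        = (q : ℝ) ^ n * ((q : ℝ) ^ n / T) := by
      have : ∀ x' : Fin n → ZMod q, ∑ y : Fin n → Y, Wn W x' y = 1 := fun x' =>
        sum_prod_one (fun i => W (x' i)) (fun i => hW1 _)
      simp_rw [← Finset.mul_sum, ← Finset.sum_div, this]
      simp [ZMod.card]
    rw [← h2]
    refine Finset.sum_le_sum fun x' _ => Finset.sum_le_sum fun y _ => ?_
    split_ifs with h
    · apply mul_le_mul_of_nonneg_left _ (by positivity)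
      rw [le_div_iff₀ hT, mul_comm]; exact h.le
    · exact mul_nonneg (by positivity) (div_nonneg (hnn _ _) hT.le)
  have hS1 : ∀ u : Fin k → ZMod q, ∑ A : Matrix (Fin k) (Fin n) (ZMod q),
      ∑ v : Fin n → ZMod q, E1 (u ᵥ* A + v) ≤ N * ((q : ℝ) ^ n * B) := by
    intro u
    have : ∀ A : Matrix (Fin k) (Fin n) (ZMod q),
        ∑ v : Fin n → ZMod q, E1 (u ᵥ* A + v) = ∑ x, E1 x := fun A =>
      Equiv.sum_comp (Equiv.addLeft (u ᵥ* A)) E1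
    simp_rw [this]
    rw [Finset.sum_const, nsmul_eq_mul, Finset.card_univ]
    exact mul_le_mul_of_nonneg_left hB (by positivity)
  have hS2 : ∀ u u' : Fin k → ZMod q, u' ≠ u → ∑ A : Matrix (Fin k) (Fin n) (ZMod q),
      ∑ v : Fin n → ZMod q, E2 (u ᵥ* A + v) (u' ᵥ* A + v) ≤ N * ((q : ℝ) ^ n / T) := by
    intro u u' hne
    have h1 : ∀ A : Matrix (Fin k) (Fin n) (ZMod q),
        ∑ v : Fin n → ZMod q, E2 (u ᵥ* A + v) (u' ᵥ* A + v)
          = ∑ x, E2 x (x + (u' - u) ᵥ* A) := by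
      intro A
      rw [← Equiv.sum_comp (Equiv.addLeft (u ᵥ* A)) (fun x => E2 x (x + (u' - u) ᵥ* A))]
      refine Finset.sum_congr rfl fun v _ => ?_
      congr 1
      rw [Matrix.sub_vecMul]
      simp only [Equiv.coe_addLeft]
      abel
    simp_rw [h1]
    have h2 := sum_mat hq (u' - u) (sub_ne_zero.2 hne) (fun w => ∑ x, E2 x (x + w))
    have hqn : (0 : ℝ) < (q : ℝ) ^ n := by positivity
    have h3 : ∑ w, ∑ x, E2 x (x + w) = ∑ x, ∑ x', E2 x x' := by
      rw [Finset.sum_comm]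
      exact Finset.sum_congr rfl fun x _ => Equiv.sum_comp (Equiv.addLeft x) (E2 x)
    rw [h3] at h2
    have h4 := mul_le_mul_of_nonneg_left hE2sum (show 0 ≤ N by positivity)
    rw [← h2, mul_left_comm] at h4
    exact le_of_mul_le_mul_left h4 hqn
  have hf : ∀ Av : Matrix (Fin k) (Fin n) (ZMod q) × (Fin n → ZMod q),
      ∃ f : (Fin n → Y) → (Fin k → ZMod q),
        ∑ u, ∑ y, (if f y ≠ u then Wn W (u ᵥ* Av.1 + Av.2) y else 0) ≤
        ∑ u, E1 (u ᵥ* Av.1 + Av.2) + ∑ u, ∑ u', (if u' ≠ u then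
          E2 (u ᵥ* Av.1 + Av.2) (u' ᵥ* Av.1 + Av.2) else 0) := fun Av =>
    dec_exists W (U := Fin k → ZMod q) hW0 T (fun u => u ᵥ* Av.1 + Av.2)
  choose f hf using hf
  clear_value E1 E2 N
  obtain ⟨⟨A, v⟩, -, hAv⟩ := Finset.exists_le_of_sum_le (s := Finset.univ)
    (f := fun Av : Matrix (Fin k) (Fin n) (ZMod q) × (Fin n → ZMod q) =>
      ∑ u, ∑ y, (if f Av y ≠ u then Wn W (u ᵥ* Av.1 + Av.2) y else 0))
    (g := fun _ => (q : ℝ) ^ k * (B + ((q : ℝ) ^ k - 1) / T)) Finset.univ_nonempty (by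
      refine (Finset.sum_le_sum fun Av _ => hf Av).trans ?_
      rw [Finset.sum_add_distrib]
      rw [Finset.sum_comm (f := fun (Av : Matrix (Fin k) (Fin n) (ZMod q) × (Fin n → ZMod q))
        (u : Fin k → ZMod q) => E1 (u ᵥ* Av.1 + Av.2))]
      rw [Finset.sum_comm (f := fun (Av : Matrix (Fin k) (Fin n) (ZMod q) × (Fin n → ZMod q))
        (u : Fin k → ZMod q) => ∑ u' : Fin k → ZMod q, (if u' ≠ u then
          E2 (u ᵥ* Av.1 + Av.2) (u' ᵥ* Av.1 + Av.2) else 0))]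
      have b1 : ∑ u : Fin k → ZMod q,
          ∑ Av : Matrix (Fin k) (Fin n) (ZMod q) × (Fin n → ZMod q), E1 (u ᵥ* Av.1 + Av.2)
          ≤ (q : ℝ) ^ k * (N * ((q : ℝ) ^ n * B)) := by
        refine (Finset.sum_le_sum (g := fun _ => N * ((q : ℝ) ^ n * B)) fun u _ => ?_).trans ?_
        · rw [Fintype.sum_prod_type]; exact hS1 u
        · simp [ZMod.card]
      have b2 : ∑ u : Fin k → ZMod q,
          ∑ Av : Matrix (Fin k) (Fin n) (ZMod q) × (Fin n → ZMod q), ∑ u' : Fin k → ZMod q,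
          (if u' ≠ u then E2 (u ᵥ* Av.1 + Av.2) (u' ᵥ* Av.1 + Av.2) else 0)
          ≤ (q : ℝ) ^ k * (((q : ℝ) ^ k - 1) * (N * ((q : ℝ) ^ n / T))) := by
        refine (Finset.sum_le_sum
          (g := fun _ => ((q : ℝ) ^ k - 1) * (N * ((q : ℝ) ^ n / T))) fun u _ => ?_).trans ?_
        · rw [Finset.sum_comm]
          have : ∀ u' : Fin k → ZMod q,
              ∑ Av : Matrix (Fin k) (Fin n) (ZMod q) × (Fin n → ZMod q),
              (if u' ≠ u then E2 (u ᵥ* Av.1 + Av.2) (u' ᵥ* Av.1 + Av.2) else 0)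
              ≤ N * ((q : ℝ) ^ n / T) - if u' = u then N * ((q : ℝ) ^ n / T) else 0 := by
            intro u'
            by_cases h : u' = u
            · simp [h]
            · simp only [h, ne_eq, not_false_eq_true, if_true, if_false, sub_zero]
              rw [Fintype.sum_prod_type]
              exact hS2 u u' h
          refine (Finset.sum_le_sum fun u' _ => this u').trans ?_
          rw [Finset.sum_sub_distrib]
          simp [ZMod.card, sub_mul]
        · simp [ZMod.card]
      refine (add_le_add b1 b2).trans (le_of_eq ?_)
      rw [Finset.sum_const, nsmul_eq_mul, Finset.card_univ, Fintype.card_prod]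
      push_cast
      rw [← hN]
      simp [ZMod.card]
      ring)
  exact ⟨A, v, f (A, v), hAv⟩

open Matrix in
lemma build (hq : q.Prime) (k n : ℕ) (A : Matrix (Fin k) (Fin n) (ZMod q))
    (v : Fin n → ZMod q) (f : (Fin n → Y) → (Fin k → ZMod q)) (E : ℝ)
    (hE : ∑ u, ∑ y, (if f y ≠ u then Wn W (u ᵥ* A + v) y else 0) ≤ (q : ℝ) ^ k * E) :
    ∃ C : AddSubgroup (Fin n → ZMod q),
    ∃ v : Fin n → ZMod q, ∃ e : Fin (q ^ k) → Fin n → ZMod q, ∃ f : (Fin n → Y) → Fin (q ^ k),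
      (∀ c ∈ C, ∀ N, c N ∈ Set.univ) ∧
      (∀ m, e m ∈ {x | ∃ c ∈ C, x = c + v}) ∧
      (∀ x ∈ {x : Fin n → ZMod q | ∃ c ∈ C, x = c + v},
        Nat.card {m : Fin (q ^ k) // e m = x} * Nat.card C = q ^ k) ∧
      avgErr W e f ≤ E := by
  have hqr : (0 : ℝ) < q := by exact_mod_cast hq.pos
  have hcard : Fintype.card (Fin k → ZMod q) = q ^ k := by simp [ZMod.card]
  let φ : (Fin k → ZMod q) ≃ Fin (q ^ k) := Fintype.equivFinOfCardEq hcard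
  let L : (Fin k → ZMod q) →+ (Fin n → ZMod q) := (Matrix.vecMulLinear A).toAddMonoidHom
  have hL : ∀ u, L u = u ᵥ* A := fun u => rfl
  refine ⟨L.range, v, fun m => φ.symm m ᵥ* A + v, fun y => φ (f y), fun _ _ _ => Set.mem_univ _,
    fun m => ⟨L (φ.symm m), ⟨_, rfl⟩, rfl⟩, ?_, ?_⟩
  · rintro x ⟨c, ⟨u, rfl⟩, rfl⟩
    have e1 : Nat.card {m : Fin (q ^ k) // φ.symm m ᵥ* A + v = L u + v} = Nat.card L.ker := by
      refine Nat.card_congr (Equiv.trans ?_ (L.fiberEquivKer u))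
      refine φ.symm.subtypeEquiv fun m => ?_
      simp [hL]
    rw [e1, ← AddSubgroup.index_ker, AddSubgroup.card_mul_index, Nat.card_eq_fintype_card, hcard]
  · unfold avgErr
    push_cast
    rw [inv_mul_le_iff₀ (by positivity)]
    refine le_trans (le_of_eq ?_) hE
    rw [← Equiv.sum_comp φ]
    simp

lemma direct (hq : q.Prime) (hW0 : ∀ x y, 0 ≤ W x y) (hW1 : ∀ x, ∑ y, W x y = 1) :
    achievable W Set.univ (CU W Finset.univ) := by
  have hl2 : 0 < Real.log 2 := Real.log_pos (by norm_num)
  have hC0 : 0 ≤ CU W Finset.univ := nonneg_of_mul_nonneg_left (CU_nonneg W hW0 hW1) hl2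
  have hqr : (0 : ℝ) < q := by exact_mod_cast hq.pos
  have hlq : 0 < Real.log q := Real.log_pos (by exact_mod_cast hq.one_lt)
  refine ⟨hC0, fun ε hε => ?_⟩
  set C0 := CU W Finset.univ with hC0def
  obtain ⟨s, hs, hr1⟩ := chernoff W hW1 ((C0 - ε / 2) * Real.log 2)
    (mul_lt_mul_of_pos_right (by linarith) hl2)
  set r := ∑ x, ∑ y, (q : ℝ)⁻¹ * W x y *
    Real.exp (s * ((C0 - ε / 2) * Real.log 2 - Real.log (W x y / outP W y))) with hr
  have hr0 : 0 ≤ r := Finset.sum_nonneg fun x _ => Finset.sum_nonneg fun y _ =>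
    mul_nonneg (mul_nonneg (by positivity) (hW0 _ _)) (Real.exp_pos _).le
  set r' := Real.exp (-(ε / 2 * Real.log 2)) with hr'
  have hr'1 : r' < 1 := by
    rw [hr', Real.exp_lt_one_iff]
    have : 0 < ε / 2 * Real.log 2 := by positivity
    linarith
  have hlim : Filter.Tendsto (fun n : ℕ => r ^ n + q * r' ^ n) Filter.atTop (nhds (0 + q * 0)) :=
    (tendsto_pow_atTop_nhds_zero_of_lt_one hr0 hr1).add
      ((tendsto_pow_atTop_nhds_zero_of_lt_one (Real.exp_pos _).le hr'1).const_mul _)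
  rw [mul_zero, add_zero] at hlim
  obtain ⟨n₀, hn₀⟩ := Filter.eventually_atTop.1 (hlim.eventually (gt_mem_nhds hε))
  refine ⟨n₀, fun n hn => ?_⟩
  have hn1 := hn₀ n hn
  set k := ⌈n * (C0 - ε) * Real.log 2 / Real.log q⌉₊ with hk
  set T := Real.exp (n * ((C0 - ε / 2) * Real.log 2)) with hT
  have hTpos : 0 < T := Real.exp_pos _
  obtain ⟨A, v, f, hf⟩ := random_coding W hq hW0 hW1 k n T (r ^ n) hTpos
    (badsum W hW0 _ s hs n)
  obtain ⟨C, v, e, f, h1, h2, h3, h4⟩ := build W hq k n A v f _ hf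
  refine ⟨q ^ k, C, v, e, f, ?_, h1, h2, h3, h4.trans (le_trans ?_ hn1.le)⟩
  · have := Nat.le_ceil (n * (C0 - ε) * Real.log 2 / Real.log q)
    rw [div_le_iff₀ hlq, ← hk] at this
    push_cast
    rw [Real.rpow_def_of_pos (by norm_num), ← Real.exp_log (show (0 : ℝ) < (q : ℝ) ^ k by positivity),
      Real.exp_le_exp, Real.log_pow]
    linarith
  · refine add_le_add le_rfl ?_
    rw [div_le_iff₀ hTpos]
    have hTr : (q : ℝ) * r' ^ n * T = Real.exp (Real.log q + n * (C0 - ε) * Real.log 2) := by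
      rw [Real.exp_add, Real.exp_log hqr, hr', ← Real.exp_nat_mul, mul_assoc, hT, ← Real.exp_add]
      congr 2
      ring
    rcases Nat.eq_zero_or_pos k with h0 | h0
    · rw [h0]; simp; positivity
    · have hpos : 0 < n * (C0 - ε) * Real.log 2 / Real.log q := Nat.ceil_pos.1 h0
      have := Nat.ceil_lt_add_one hpos.le
      rw [← hk] at this
      have h5 : k * Real.log q ≤ Real.log q + n * (C0 - ε) * Real.log 2 := by
        have := mul_le_mul_of_nonneg_right this.le hlq.le
        rw [add_mul, div_mul_cancel₀ _ hlq.ne'] at this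
        linarith
      rw [hTr]
      have h6 : (q : ℝ) ^ k = Real.exp (k * Real.log q) := by
        rw [← Real.log_pow, Real.exp_log (by positivity)]
      have h7 := Real.exp_le_exp.2 h5
      rw [← h6] at h7
      linarith

end

/-- **Capacity of linear (affine) codes over `ℤ_q`, `q` prime** (Section 4.A).
For a DMC whose input alphabet is the field `ℤ_q` with `q` prime, the capacity of
shifted group codes over `ℤ_q` equals `C^U_{|ℤ_q|}`, the mutual information between a
uniformly distributed input and the corresponding output. -/
theorem capacity_of_linear_codes (q : ℕ) [NeZero q] (hq : q.Prime)
    {Y : Type*} [Fintype Y] (W : ZMod q → Y → ℝ)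
    (hW0 : ∀ x y, 0 ≤ W x y) (hW1 : ∀ x, ∑ y, W x y = 1) :
    capacity W Set.univ = CU W Finset.univ := by
  exact IsGreatest.csSup_eq ⟨direct W hq hW0 hW1, fun R hR => converse W hq hW0 hW1 R hR⟩

end
end

section
/- Let p be a prime, r, k, n positive integers, and θ ∈ {0,…,r−1}. Let a ∈ (ℤ_{p^r})^k be such that every component a_l lies in the subgroup p^θ ℤ_{p^r} and some component a_m does not lie in p^{θ+1} ℤ_{p^r}. Fix any u ∈ (ℤ_{p^r})^k and any h, x ∈ (ℤ_{p^r})^n. Then the number of pairs (G, v), where G is a k × n matrix over ℤ_{p^r} and v ∈ (ℤ_{p^r})^n, satisfying aG = h and uG + v = x, equals p^{nθ} · p^{nr(k−1)} if every component of h lies in p^θ ℤ_{p^r}, and equals 0 otherwise. -/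
open scoped BigOperators Classical

def colHom {N k : ℕ} (a : Fin k → ZMod N) : (Fin k → ZMod N) →+ ZMod N where
  toFun g := ∑ l, a l * g l
  map_zero' := by simp
  map_add' g g' := by simp [mul_add, Finset.sum_add_distrib]

lemma colHom_range (p r k θ : ℕ) (hp : p.Prime)
    (a : Fin k → ZMod (p ^ r))
    (ha1 : ∀ l, ∃ c, a l = (p : ZMod (p ^ r)) ^ θ * c)
    (ha2 : ∃ m, ¬ ∃ c, a m = (p : ZMod (p ^ r)) ^ (θ + 1) * c) (y : ZMod (p ^ r)) :
    (∃ g, colHom a g = y) ↔ ∃ c, y = (p : ZMod (p ^ r)) ^ θ * c := by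
  haveI : NeZero (p ^ r) := ⟨pow_ne_zero _ hp.ne_zero⟩
  constructor
  · rintro ⟨g, rfl⟩
    choose c hc using ha1
    refine ⟨∑ l, c l * g l, ?_⟩
    rw [Finset.mul_sum]
    change ∑ l, a l * g l = _
    exact Finset.sum_congr rfl fun l _ => by rw [hc l, mul_assoc]
  · rintro ⟨d, rfl⟩
    obtain ⟨m, hm⟩ := ha2
    obtain ⟨c, hc⟩ := ha1 m
    have hu : IsUnit c := by
      rw [← ZMod.natCast_zmod_val c, ZMod.isUnit_iff_coprime]
      apply Nat.Coprime.pow_right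
      rw [Nat.coprime_comm, hp.coprime_iff_not_dvd]
      rintro ⟨t, ht⟩
      apply hm
      refine ⟨(t : ZMod (p ^ r)), ?_⟩
      rw [hc, ← ZMod.natCast_zmod_val c, ht]
      push_cast
      ring
    obtain ⟨w, rfl⟩ := hu
    refine ⟨Pi.single m ((↑w⁻¹ : ZMod (p ^ r)) * d), ?_⟩
    change ∑ l, a l * _ = _
    rw [Finset.sum_eq_single m]
    · rw [Pi.single_eq_same, hc, mul_assoc, Units.mul_inv_cancel_left]
    · intro b _ hb
      simp [hb]
    · simp

lemma col_card (p r k θ : ℕ) (hp : p.Prime) (hk : 0 < k) (hθ : θ < r)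
    (a : Fin k → ZMod (p ^ r))
    (ha1 : ∀ l, ∃ c, a l = (p : ZMod (p ^ r)) ^ θ * c)
    (ha2 : ∃ m, ¬ ∃ c, a m = (p : ZMod (p ^ r)) ^ (θ + 1) * c) (y : ZMod (p ^ r))
    (hy : ∃ c, y = (p : ZMod (p ^ r)) ^ θ * c) :
    Nat.card {g : Fin k → ZMod (p ^ r) // ∑ l, a l * g l = y} = p ^ θ * p ^ (r * (k - 1)) := by
  haveI : NeZero (p ^ r) := ⟨pow_ne_zero _ hp.ne_zero⟩
  have hR := colHom_range p r k θ hp a ha1 ha2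
  obtain ⟨g0, hg0⟩ := (hR y).2 hy
  have e : {g : Fin k → ZMod (p ^ r) // ∑ l, a l * g l = y} ≃ (colHom a).ker :=
    (Equiv.subRight g0).subtypeEquiv (fun g => by
      simp only [Equiv.subRight_apply, AddMonoidHom.mem_ker, map_sub, hg0, sub_eq_zero]
      rfl)
  rw [Nat.card_congr e]
  have h1 := AddSubgroup.card_mul_index (colHom a).ker
  rw [AddSubgroup.index_ker] at h1
  have h2 : (colHom a).range = AddSubgroup.zmultiples ((p ^ θ : ℕ) : ZMod (p ^ r)) := by
    ext z
    rw [AddMonoidHom.mem_range, hR, AddSubgroup.mem_zmultiples_iff]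
    constructor
    · rintro ⟨c, rfl⟩
      refine ⟨c.val, ?_⟩
      simp [mul_comm]
    · rintro ⟨c, rfl⟩
      exact ⟨c, by simp [mul_comm]⟩
  have h3 : Nat.card (colHom a).range = p ^ (r - θ) := by
    rw [h2, Nat.card_zmultiples, ZMod.addOrderOf_coe _ (NeZero.ne _),
      Nat.gcd_eq_right (pow_dvd_pow p hθ.le), Nat.pow_div hθ.le hp.pos]
  have h4 : Nat.card (Fin k → ZMod (p ^ r)) = p ^ (r * k) := by
    simp [pow_mul]
  rw [h3, h4] at h1
  apply Nat.eq_of_mul_eq_mul_right (pow_pos hp.pos (r - θ))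
  rw [h1, ← pow_add, ← pow_add]
  congr 1
  obtain ⟨k, rfl⟩ := Nat.exists_eq_succ_of_ne_zero hk.ne'
  simp only [Nat.succ_eq_add_one, Nat.add_sub_cancel, mul_add]
  omega

/-- **Counting generator matrices and dithers** (Lemma 5.1, case `θ`).
Let `p` be a prime, `θ < r`, and `a ∈ (ℤ_{p^r})^k` with every component in `p^θ ℤ_{p^r}`
and some component not in `p^{θ+1} ℤ_{p^r}`. For any `u ∈ (ℤ_{p^r})^k` and
`h, x ∈ (ℤ_{p^r})^n`, the number of pairs `(G, v)` of a `k × n` matrix `G` over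
`ℤ_{p^r}` and a vector `v ∈ (ℤ_{p^r})^n` with `aG = h` and `uG + v = x` equals
`p^{nθ} p^{nr(k-1)}` if every component of `h` lies in `p^θ ℤ_{p^r}`, and `0` otherwise. -/
theorem count_generator_dither_pairs
    (p r k n θ : ℕ) (hp : p.Prime) (hr : 0 < r) (hk : 0 < k) (hn : 0 < n)
    (hθ : θ < r)
    (a : Fin k → ZMod (p ^ r))
    (ha1 : ∀ l, ∃ c, a l = (p : ZMod (p ^ r)) ^ θ * c)
    (ha2 : ∃ m, ¬ ∃ c, a m = (p : ZMod (p ^ r)) ^ (θ + 1) * c)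
    (u : Fin k → ZMod (p ^ r)) (h x : Fin n → ZMod (p ^ r)) :
    Nat.card {Gv : Matrix (Fin k) (Fin n) (ZMod (p ^ r)) × (Fin n → ZMod (p ^ r)) //
        (∀ j, ∑ l, a l * Gv.1 l j = h j) ∧ (∀ j, (∑ l, u l * Gv.1 l j) + Gv.2 j = x j)} =
      if ∀ j, ∃ c, h j = (p : ZMod (p ^ r)) ^ θ * c
        then p ^ (n * θ) * p ^ (n * r * (k - 1))
        else 0 := by
  haveI : NeZero (p ^ r) := ⟨pow_ne_zero _ hp.ne_zero⟩
  let e : {Gv : Matrix (Fin k) (Fin n) (ZMod (p ^ r)) × (Fin n → ZMod (p ^ r)) //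
        (∀ j, ∑ l, a l * Gv.1 l j = h j) ∧ (∀ j, (∑ l, u l * Gv.1 l j) + Gv.2 j = x j)} ≃
      ((j : Fin n) → {g : Fin k → ZMod (p ^ r) // ∑ l, a l * g l = h j}) :=
    { toFun := fun G j => ⟨fun l => G.1.1 l j, G.2.1 j⟩
      invFun := fun g => ⟨(fun l j => (g j).1 l, fun j => x j - ∑ l, u l * (g j).1 l),
        fun j => (g j).2, fun j => by simp⟩
      left_inv := by
        rintro ⟨⟨G, v⟩, h1, h2⟩
        apply Subtype.ext
        refine Prod.ext rfl ?_
        funext j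
        exact sub_eq_of_eq_add' (h2 j).symm
      right_inv := fun g => rfl }
  rw [Nat.card_congr e, Nat.card_pi]
  split_ifs with hh
  · rw [Finset.prod_congr rfl fun j _ => col_card p r k θ hp hk hθ a ha1 ha2 (h j) (hh j)]
    simp only [Finset.prod_const, Finset.card_univ, Fintype.card_fin]
    rw [mul_pow, ← pow_mul, ← pow_mul]
    congr 2 <;> ring
  · push Not at hh
    obtain ⟨j, hj⟩ := hh
    apply Finset.prod_eq_zero (Finset.mem_univ j)
    rw [Nat.card_eq_zero]
    left
    refine ⟨fun g => ?_⟩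
    obtain ⟨c, hc⟩ := (colHom_range p r k θ hp a ha1 ha2 (h j)).1 ⟨g.1, g.2⟩
    exact hj c hc
end

section
/- Let p_1,…,p_I be primes, r_1,…,r_I and k_1,…,k_I positive integers, G = ⊕_{i=1}^I ℤ_{p_i^{r_i}}, and n a positive integer. Consider the random ensemble consisting of independent uniformly random matrices G_i over ℤ_{p_i^{r_i}} of size k_i × n (i = 1,…,I) and an independent uniformly random dither v ∈ G^n, with encoder e(u) ∈ G^n defined for u = (u_1,…,u_I) ∈ ⊕_{i=1}^I (ℤ_{p_i^{r_i}})^{k_i} by letting the ℤ_{p_i^{r_i}}-component sequence of e(u) be u_i G_i + v_i. Let u, ũ be two inputs with a = u − ũ ≠ 0, and for each i let θ_i be the smallest θ ∈ {0,…,r_i−1} such that some component a_{iK} lies in p_i^{θ} ℤ_{p_i^{r_i}} \ p_i^{θ+1} ℤ_{p_i^{r_i}}, with θ_i = r_i if the i-th block of a is zero. Then for all x, x̃ ∈ G^n: P(e(u) = x and e(ũ) = x̃) = ∏_{i=1}^I p_i^{−n(2 r_i − θ_i)} if x̃ − x ∈ H_θ^n, and 0 otherwise; equivalently P(e(ũ)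 = x̃ | e(u) = x) = ∏_{i=1}^I p_i^{−n(r_i − θ_i)} if x̃ − x ∈ H_θ^n, and 0 otherwise. -/
open scoped BigOperators Classical

noncomputable section

/-- The random-ensemble encoder: given generator matrices `Gm i` of size `kᵢ × n` over
`ℤ_{pᵢ^{rᵢ}}` and a dither `v ∈ Gⁿ`, the input `u ∈ ⊕ᵢ (ℤ_{pᵢ^{rᵢ}})^{kᵢ}` is mapped to
the codeword whose `ℤ_{pᵢ^{rᵢ}}`-component sequence is `uᵢ Gmᵢ + vᵢ`. -/
def ensembleEncode {I : ℕ} (p r k : Fin I → ℕ) (n : ℕ)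
    (Gm : ∀ i, Matrix (Fin (k i)) (Fin n) (ZMod (p i ^ r i)))
    (v : Fin n → ∀ i, ZMod (p i ^ r i))
    (u : ∀ i, Fin (k i) → ZMod (p i ^ r i)) :
    Fin n → ∀ i, ZMod (p i ^ r i) :=
  fun N i => (∑ K, u i K * Gm i K N) + v N i

theorem epp_sub_iff {I : ℕ} (p r k : Fin I → ℕ) (hp : ∀ i, (p i).Prime) (n : ℕ)
    (u ut : ∀ i, Fin (k i) → ZMod (p i ^ r i))
    (θ : Fin I → ℕ)
    (hθ1 : ∀ i K, ∃ c, u i K - ut i K = (p i : ZMod (p i ^ r i)) ^ θ i * c)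
    (hθ2 : ∀ i, (¬ ∀ K, u i K = ut i K) →
      ∃ K, ¬ ∃ c, u i K - ut i K = (p i : ZMod (p i ^ r i)) ^ (θ i + 1) * c)
    (hθ3 : ∀ i, (∀ K, u i K = ut i K) → θ i = r i)
    (y : Fin n → ∀ i, ZMod (p i ^ r i)) :
    (∃ Gm : ∀ i, Matrix (Fin (k i)) (Fin n) (ZMod (p i ^ r i)),
      (fun N i => ∑ K, (ut i K - u i K) * Gm i K N) = y) ↔
      ∀ N i, ∃ c, y N i = (p i : ZMod (p i ^ r i)) ^ θ i * c := by
  constructor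
  · rintro ⟨Gm, rfl⟩ N i
    choose c hc using hθ1 i
    refine ⟨∑ K, (- c K) * Gm i K N, ?_⟩
    rw [Finset.mul_sum]
    refine Finset.sum_congr rfl fun K _ => ?_
    rw [← neg_sub, hc]; ring
  · intro h
    have key : ∀ i N, ∃ g : Fin (k i) → ZMod (p i ^ r i),
        ∑ K, (ut i K - u i K) * g K = y N i := by
      intro i N
      obtain ⟨c, hc⟩ := h N i
      by_cases hz : ∀ K, u i K = ut i K
      · refine ⟨0, ?_⟩
        rw [hc, hθ3 i hz, ← Nat.cast_pow, ZMod.natCast_self]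
        simp
      · obtain ⟨K, hK⟩ := hθ2 i hz
        obtain ⟨d, hd⟩ := hθ1 i K
        have : NeZero (p i ^ r i) := ⟨pow_ne_zero _ (hp i).ne_zero⟩
        have hu : IsUnit d := by
          rw [← ZMod.natCast_zmod_val d, ZMod.isUnit_iff_coprime]
          apply Nat.Coprime.pow_right
          rw [Nat.coprime_comm, (hp i).coprime_iff_not_dvd]
          rintro ⟨e, he⟩
          apply hK
          refine ⟨e, ?_⟩
          rw [hd, ← ZMod.natCast_zmod_val d, he]
          push_cast
          ring
        obtain ⟨w, rfl⟩ := hu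
        refine ⟨Pi.single K (-(↑w⁻¹ * c)), ?_⟩
        rw [Finset.sum_eq_single K]
        · rw [Pi.single_eq_same, ← neg_sub, hd, hc]
          calc _ = (p i : ZMod (p i ^ r i)) ^ θ i * ((w * ↑w⁻¹ : ZMod (p i ^ r i)) * c) := by ring
            _ = _ := by rw [Units.mul_inv, one_mul]
        · intro b _ hb
          rw [Pi.single_eq_of_ne hb, mul_zero]
        · simp
    choose g hg using key
    exact ⟨fun i => Matrix.of fun K N => g i N K, by funext N i; exact hg i N⟩

theorem epp_card_range (p r t : ℕ) (hp : p.Prime) (ht : t ≤ r) :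
    Nat.card {y : ZMod (p ^ r) // ∃ c, y = (p : ZMod (p ^ r)) ^ t * c} = p ^ (r - t) := by
  have h0 : p ^ r ≠ 0 := pow_ne_zero _ hp.ne_zero
  have : NeZero (p ^ r) := ⟨h0⟩
  have e : {y : ZMod (p ^ r) // ∃ c, y = (p : ZMod (p ^ r)) ^ t * c} ≃
      AddSubgroup.zmultiples (((p ^ t : ℕ) : ZMod (p ^ r))) := by
    refine Equiv.subtypeEquivRight fun y => ?_
    rw [AddSubgroup.mem_zmultiples_iff]
    constructor
    · rintro ⟨c, rfl⟩
      refine ⟨c.val, ?_⟩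
      rw [zsmul_eq_mul, Int.cast_natCast, ZMod.natCast_zmod_val]
      push_cast; ring
    · rintro ⟨z, rfl⟩
      refine ⟨z, ?_⟩
      rw [zsmul_eq_mul]; push_cast; ring
  rw [Nat.card_congr e, Nat.card_zmultiples, ZMod.addOrderOf_coe _ h0,
    Nat.gcd_eq_right (pow_dvd_pow p ht), Nat.pow_div ht hp.pos]

theorem epp_card_H {I : ℕ} (p r : Fin I → ℕ) (hp : ∀ i, (p i).Prime) (n : ℕ)
    (θ : Fin I → ℕ) (hθr : ∀ i, θ i ≤ r i) :
    Nat.card {y : Fin n → ∀ i, ZMod (p i ^ r i) //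
      ∀ N i, ∃ c, y N i = (p i : ZMod (p i ^ r i)) ^ θ i * c} =
      ∏ i, p i ^ (n * (r i - θ i)) := by
  have e : {y : Fin n → ∀ i, ZMod (p i ^ r i) //
      ∀ N i, ∃ c, y N i = (p i : ZMod (p i ^ r i)) ^ θ i * c} ≃
      (Fin n → ∀ i, {y : ZMod (p i ^ r i) // ∃ c, y = (p i : ZMod (p i ^ r i)) ^ θ i * c}) :=
    { toFun := fun y N i => ⟨y.1 N i, y.2 N i⟩
      invFun := fun y => ⟨fun N i => (y N i).1, fun N i => (y N i).2⟩
      left_inv := fun _ => rfl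
      right_inv := fun _ => rfl }
  rw [Nat.card_congr e, Nat.card_pi, Finset.prod_const, Nat.card_pi, Finset.card_univ,
    Fintype.card_fin, ← Finset.prod_pow]
  refine Finset.prod_congr rfl fun i _ => ?_
  rw [epp_card_range _ _ _ (hp i) (hθr i), ← pow_mul, mul_comm]

def eppHom {I : ℕ} (p r k : Fin I → ℕ) (n : ℕ) (a : ∀ i, Fin (k i) → ZMod (p i ^ r i)) :
    (∀ i, Matrix (Fin (k i)) (Fin n) (ZMod (p i ^ r i))) →+ (Fin n → ∀ i, ZMod (p i ^ r i)) where
  toFun Gm := fun N i => ∑ K, a i K * Gm i K N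
  map_zero' := by funext N i; simp
  map_add' A B := by
    funext N i
    simp [mul_add, Finset.sum_add_distrib]

theorem epp_fiber {A B : Type*} [AddCommGroup A] [AddCommGroup B] (f : A →+ B) (y : B)
    (hy : ∃ a, f a = y) : Nat.card {a // f a = y} * Nat.card {b // ∃ a, f a = b} = Nat.card A := by
  obtain ⟨a, rfl⟩ := hy
  have h1 : Nat.card {b // f b = f a} = Nat.card f.ker :=
    Nat.card_congr (f.fiberEquivKer a)
  have h2 : Nat.card {b // ∃ a, f a = b} = f.ker.index := by
    rw [AddSubgroup.index_ker]
    rfl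
  rw [h1, h2, AddSubgroup.card_mul_index]

/-- **Pairwise probabilities of the random homomorphic ensemble** (Lemma 3.2).
Let `u ≠ ũ`, `a = u - ũ`, and for each `i` let `θᵢ` be the smallest `θ ∈ {0,…,rᵢ-1}`
such that some component `a_{iK} ∈ pᵢ^θ ℤ_{pᵢ^{rᵢ}} \ pᵢ^{θ+1} ℤ_{pᵢ^{rᵢ}}` (with
`θᵢ = rᵢ` when the `i`-th block of `a` vanishes).  Then, with respect to the uniform
independent choice of the matrices `Gm i` and of the dither `v`,
`P(e(u) = x, e(ũ) = x̃) = ∏ᵢ pᵢ^{-n(2rᵢ-θᵢ)}` if `x̃ - x ∈ H_θⁿ` and `0` otherwise;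
equivalently `P(e(ũ) = x̃ | e(u) = x) = ∏ᵢ pᵢ^{-n(rᵢ-θᵢ)}` if `x̃ - x ∈ H_θⁿ` and `0`
otherwise. -/
theorem ensemble_pairwise_probability
    {I : ℕ} (p r k : Fin I → ℕ) (hp : ∀ i, (p i).Prime) (hr : ∀ i, 0 < r i)
    (hk : ∀ i, 0 < k i) (n : ℕ) (hn : 0 < n)
    (u ut : ∀ i, Fin (k i) → ZMod (p i ^ r i)) (hne : u ≠ ut)
    (θ : Fin I → ℕ) (hθr : ∀ i, θ i ≤ r i)
    (hθ1 : ∀ i K, ∃ c, u i K - ut i K = (p i : ZMod (p i ^ r i)) ^ θ i * c)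
    (hθ2 : ∀ i, (¬ ∀ K, u i K = ut i K) →
      ∃ K, ¬ ∃ c, u i K - ut i K = (p i : ZMod (p i ^ r i)) ^ (θ i + 1) * c)
    (hθ3 : ∀ i, (∀ K, u i K = ut i K) → θ i = r i) :
    ∀ x xt : Fin n → ∀ i, ZMod (p i ^ r i),
      ((Nat.card {ω : (∀ i, Matrix (Fin (k i)) (Fin n) (ZMod (p i ^ r i))) ×
            (Fin n → ∀ i, ZMod (p i ^ r i)) //
            ensembleEncode p r k n ω.1 ω.2 u = x ∧ ensembleEncode p r k n ω.1 ω.2 ut = xt} : ℝ) /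
          (Nat.card ((∀ i, Matrix (Fin (k i)) (Fin n) (ZMod (p i ^ r i))) ×
            (Fin n → ∀ i, ZMod (p i ^ r i))) : ℝ) =
        if ∀ N i, ∃ c, xt N i - x N i = (p i : ZMod (p i ^ r i)) ^ θ i * c
          then ∏ i, ((p i : ℝ) ^ (n * (2 * r i - θ i)))⁻¹
          else 0) ∧
      ((Nat.card {ω : (∀ i, Matrix (Fin (k i)) (Fin n) (ZMod (p i ^ r i))) ×
            (Fin n → ∀ i, ZMod (p i ^ r i)) //
            ensembleEncode p r k n ω.1 ω.2 u = x ∧ ensembleEncode p r k n ω.1 ω.2 ut = xt} : ℝ) /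
          (Nat.card {ω : (∀ i, Matrix (Fin (k i)) (Fin n) (ZMod (p i ^ r i))) ×
            (Fin n → ∀ i, ZMod (p i ^ r i)) //
            ensembleEncode p r k n ω.1 ω.2 u = x} : ℝ) =
        if ∀ N i, ∃ c, xt N i - x N i = (p i : ZMod (p i ^ r i)) ^ θ i * c
          then ∏ i, ((p i : ℝ) ^ (n * (r i - θ i)))⁻¹
          else 0) := by
  intro x xt
  have : ∀ i, NeZero (p i ^ r i) := fun i => ⟨pow_ne_zero _ (hp i).ne_zero⟩
  have c1 : Nat.card {ω : (∀ i, Matrix (Fin (k i)) (Fin n) (ZMod (p i ^ r i))) ×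
            (Fin n → ∀ i, ZMod (p i ^ r i)) //
            ensembleEncode p r k n ω.1 ω.2 u = x} =
      Nat.card (∀ i, Matrix (Fin (k i)) (Fin n) (ZMod (p i ^ r i))) := by
    refine Nat.card_congr
      { toFun := fun ω => ω.1.1
        invFun := fun Gm => ⟨(Gm, x - eppHom p r k n u Gm), ?_⟩
        left_inv := ?_
        right_inv := fun _ => rfl }
    · change eppHom p r k n u Gm + (x - eppHom p r k n u Gm) = x
      abel
    · rintro ⟨⟨Gm, v⟩, h⟩
      change eppHom p r k n u Gm + v = x at h
      subst h
      simp
  have c2 : Nat.card {ω : (∀ i, Matrix (Fin (k i)) (Fin n) (ZMod (p i ^ r i))) ×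
            (Fin n → ∀ i, ZMod (p i ^ r i)) //
            ensembleEncode p r k n ω.1 ω.2 u = x ∧ ensembleEncode p r k n ω.1 ω.2 ut = xt} =
      Nat.card {Gm // eppHom p r k n (ut - u) Gm = xt - x} := by
    have hs : ∀ Gm, eppHom p r k n (ut - u) Gm = eppHom p r k n ut Gm - eppHom p r k n u Gm := by
      intro Gm
      funext N i
      simp [eppHom, sub_mul]
    refine Nat.card_congr
      { toFun := fun ω => ⟨ω.1.1, ?_⟩
        invFun := fun Gm => ⟨(Gm.1, x - eppHom p r k n u Gm.1), ?_, ?_⟩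
        left_inv := ?_
        right_inv := fun _ => rfl }
    · obtain ⟨⟨Gm, v⟩, h1, h2⟩ := ω
      change eppHom p r k n u Gm + v = x at h1
      change eppHom p r k n ut Gm + v = xt at h2
      rw [hs]
      change eppHom p r k n ut Gm - eppHom p r k n u Gm = xt - x
      generalize eppHom p r k n ut Gm = A at *
      generalize eppHom p r k n u Gm = B at *
      rw [← h1, ← h2]
      abel
    · change eppHom p r k n u Gm.1 + (x - eppHom p r k n u Gm.1) = x
      abel
    · change eppHom p r k n ut Gm.1 + (x - eppHom p r k n u Gm.1) = xt
      have := Gm.2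
      rw [hs] at this
      generalize eppHom p r k n ut Gm.1 = A at *
      generalize eppHom p r k n u Gm.1 = B at *
      rw [← sub_add_cancel xt x, ← this]
      abel
    · rintro ⟨⟨Gm, v⟩, h, h2⟩
      change eppHom p r k n u Gm + v = x at h
      subst h
      simp
  have hiff : ∀ y, (∃ Gm, eppHom p r k n (ut - u) Gm = y) ↔
      ∀ N i, ∃ c, y N i = (p i : ZMod (p i ^ r i)) ^ θ i * c :=
    fun y => epp_sub_iff p r k hp n u ut θ hθ1 hθ2 hθ3 y
  have c3 : Nat.card (Fin n → ∀ i, ZMod (p i ^ r i)) = ∏ i, p i ^ (n * r i) := by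
    rw [Nat.card_pi, Finset.prod_const, Nat.card_pi, Finset.card_univ,
      Fintype.card_fin, ← Finset.prod_pow]
    refine Finset.prod_congr rfl fun i _ => ?_
    rw [Nat.card_zmod, ← pow_mul, mul_comm]
  have hM : (Nat.card (∀ i, Matrix (Fin (k i)) (Fin n) (ZMod (p i ^ r i))) : ℝ) ≠ 0 := by
    have : ∀ i, Finite (Matrix (Fin (k i)) (Fin n) (ZMod (p i ^ r i))) := fun i =>
      inferInstanceAs (Finite (Fin (k i) → Fin n → ZMod (p i ^ r i)))
    exact_mod_cast Nat.card_pos.ne'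
  have hp0 : ∀ i, (p i : ℝ) ≠ 0 := fun i => by exact_mod_cast (hp i).ne_zero
  rw [c1, c2, Nat.card_prod, c3]
  split_ifs with hc
  · have hf := epp_fiber (eppHom p r k n (ut - u)) (xt - x) ((hiff _).2 hc)
    rw [Nat.card_congr (Equiv.subtypeEquivRight hiff), epp_card_H p r hp n θ hθr] at hf
    have hf' : ((Nat.card {Gm // eppHom p r k n (ut - u) Gm = xt - x} : ℕ) : ℝ) *
        ∏ i, (p i : ℝ) ^ (n * (r i - θ i)) =
        (Nat.card (∀ i, Matrix (Fin (k i)) (Fin n) (ZMod (p i ^ r i))) : ℝ) := by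
      exact_mod_cast hf
    have h1 : ∏ i, (p i : ℝ) ^ (n * (r i - θ i)) ≠ 0 :=
      Finset.prod_ne_zero_iff.2 fun i _ => pow_ne_zero _ (hp0 i)
    have h2 : ∏ i, (p i : ℝ) ^ (n * r i) ≠ 0 :=
      Finset.prod_ne_zero_iff.2 fun i _ => pow_ne_zero _ (hp0 i)
    have h3 : ∏ i, (p i : ℝ) ^ (n * (2 * r i - θ i)) =
        (∏ i, (p i : ℝ) ^ (n * (r i - θ i))) * ∏ i, (p i : ℝ) ^ (n * r i) := by
      rw [← Finset.prod_mul_distrib]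
      refine Finset.prod_congr rfl fun i _ => ?_
      rw [← pow_add, ← mul_add]
      have := hθr i
      congr 2
      omega
    rw [Finset.prod_inv_distrib, Finset.prod_inv_distrib, h3]
    push_cast
    rw [← hf'] at hM ⊢
    have h4 := left_ne_zero_of_mul hM
    constructor <;> field_simp
  · have : IsEmpty {Gm // eppHom p r k n (ut - u) Gm = xt - x} :=
      ⟨fun g => hc ((hiff _).1 ⟨g.1, g.2⟩)⟩
    rw [Nat.card_of_isEmpty]
    simp

end
end
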